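/- The following groups are isomorphic: (1) the group of all ℝ-algebra automorphisms of the octonions 𝕆; (2) the automorphism group of the algebra (Im 𝕆, ×); (3) the subgroup {g ∈ SO(7) : g*φ = φ} of SO(7) preserving the associative 3-form φ. This common group G₂ is a 14-dimensional compact, connected, simple and simply connected Lie group contained in SO(7). -/

import Mathlib

/-!
STATEMENT 18. The following groups are isomorphic: (1) the group of all `ℝ`-algebra
automorphisms of the octonions `𝕆`; (2) the automorphism group of the algebra
`(Im 𝕆, ×)`; (3) the subgroup `{g ∈ SO(7) : g*φ = φ}` of `SO(7)` preserving the
associative 3-form `φ`.  This common group `G₂` is a 14-dimensional compact, connected,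
simple and simply connected Lie group contained in `SO(7)`.

The octonions are obtained from the quaternions by the Cayley–Dickson construction,
`Im 𝕆 ≅ ℝ⁷` is the purely imaginary part with the cross product `x × y = (x·y − y·x)/2`
and the inner product `⟨x,y⟩ = Re (x ȳ)`; the associative 3-form is
`φ(x,y,z) = ⟨x × y, z⟩` (which on the standard basis has the coefficients `f^{ijk}` of
the cross product, i.e. the expression `w¹²³ − w¹⁴⁵ − w¹⁶⁷ − w²⁴⁶ + w²⁵⁷ − w³⁴⁷ − w³⁵⁶`).
`SO(7)` acts on `Im 𝕆 ≅ ℝ⁷`; an element of `SO(7)` is an inner-product-preserving linear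
automorphism of `Im 𝕆` of determinant `1`, and it preserves `φ` iff it preserves the
cross product 3-form.  `G₂` is topologized as a subspace of the maps `𝕆 → 𝕆`;
"14-dimensional Lie group" is rendered by `G₂` being a topological group (automatic here)
which is a manifold locally modelled on `ℝ¹⁴`.
-/

noncomputable section

/-- The octonions, obtained from the quaternions by the Cayley–Dickson construction. -/
def Octonion : Type := Quaternion ℝ × Quaternion ℝ

namespace Octonion

instance : AddCommGroup Octonion :=
  inferInstanceAs (AddCommGroup (Quaternion ℝ × Quaternion ℝ))

instance : Module ℝ Octonion :=
  inferInstanceAs (Module ℝ (Quaternion ℝ × Quaternion ℝ))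

instance : TopologicalSpace Octonion :=
  inferInstanceAs (TopologicalSpace (Quaternion ℝ × Quaternion ℝ))

instance : One Octonion := ⟨((1 : Quaternion ℝ), (0 : Quaternion ℝ))⟩

/-- Cayley–Dickson multiplication: `(a,b)(c,d) = (ac − d b̄, ā d + c b)`. -/
instance : Mul Octonion :=
  ⟨fun x y => (x.1 * y.1 - y.2 * star x.2, star x.1 * y.2 + y.1 * x.2)⟩

/-- Octonion conjugation: `(a,b)* = (ā, −b)`. -/
instance : Star Octonion := ⟨fun x => (star x.1, -x.2)⟩

/-- The real part of an octonion. -/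
def re (x : Octonion) : ℝ := x.1.re

/-- The purely imaginary part `Im 𝕆 ≅ ℝ⁷` of the octonions. -/
def ImO : Submodule ℝ Octonion where
  carrier := {x | re x = 0}
  add_mem' := by
    intro a b ha hb
    show ((a + b : Octonion).1).re = 0
    have : (a + b : Octonion).1 = a.1 + b.1 := rfl
    rw [this]
    simp only [Quaternion.re_add]
    exact (congrArg₂ (· + ·) ha hb).trans (add_zero 0)
  zero_mem' := by
    show ((0 : Octonion).1).re = 0
    rfl
  smul_mem' := by
    intro c x hx
    show ((c • x : Octonion).1).re = 0
    have h1 : (c • x : Octonion).1 = c • x.1 := rfl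
    have hx' : (x.1).re = 0 := hx
    rw [h1]
    simp [Quaternion.re_smul, hx']

/-- The inner product of `𝕆`: `⟨x, y⟩ = Re (x ȳ)`. -/
def oinner (x y : Octonion) : ℝ := re (x * star y)

/-- The cross product on `𝕆`: `x × y = (x·y − y·x)/2`. -/
def cross (x y : Octonion) : Octonion := (2⁻¹ : ℝ) • (x * y - y * x)

lemma re_mul_comm (x y : Octonion) : re (x * y) = re (y * x) := by
  show ((x * y : Octonion).1).re = ((y * x : Octonion).1).re
  have h1 : (x * y : Octonion).1 = x.1 * y.1 - y.2 * star x.2 := rfl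
  have h2 : (y * x : Octonion).1 = y.1 * x.1 - x.2 * star y.2 := rfl
  rw [h1, h2]
  simp only [Quaternion.re_sub, Quaternion.re_mul, Quaternion.re_star,
    Quaternion.imI_star, Quaternion.imJ_star, Quaternion.imK_star]
  ring

lemma re_cross (x y : Octonion) : re (cross x y) = 0 := by
  show ((cross x y).1).re = 0
  have h1 : (cross x y).1 = (2⁻¹ : ℝ) • ((x * y : Octonion).1 - (y * x : Octonion).1) := rfl
  rw [h1]
  have := re_mul_comm x y
  simp only [Quaternion.re_smul, Quaternion.re_sub, smul_eq_mul]
  have h2 : ((x * y : Octonion).1).re = ((y * x : Octonion).1).re := this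
  rw [h2]
  ring

/-- The cross product as an operation on `Im 𝕆` (for purely imaginary octonions the
cross product is again purely imaginary; in fact `Re (x·y − y·x) = 0` always). -/
def crossI (x y : ImO) : ImO := ⟨cross (x : Octonion) (y : Octonion), re_cross _ _⟩

end Octonion

/-- (1) `G₂`, the group of all `ℝ`-algebra automorphisms of the octonions. -/
def G2 : Subgroup (Octonion ≃ₗ[ℝ] Octonion) where
  carrier := {g | ∀ x y : Octonion, g (x * y) = g x * g y}
  one_mem' := fun _ _ => rfl
  mul_mem' := by
    intro f g hf hg x y
    show f (g (x * y)) = f (g x) * f (g y)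
    rw [hg, hf]
  inv_mem' := by
    intro f hf x y
    apply f.injective
    show f (f.symm (x * y)) = f (f.symm x * f.symm y)
    rw [hf, f.apply_symm_apply, f.apply_symm_apply, f.apply_symm_apply]

open Octonion in
/-- (2) The automorphism group of the algebra `(Im 𝕆, ×)`. -/
def AutImOCross : Subgroup ((ImO : Submodule ℝ Octonion) ≃ₗ[ℝ] (ImO : Submodule ℝ Octonion)) where
  carrier := {g | ∀ x y : ImO, g (crossI x y) = crossI (g x) (g y)}
  one_mem' := fun _ _ => rfl
  mul_mem' := by
    intro f g hf hg x y
    show f (g (crossI x y)) = crossI (f (g x)) (f (g y))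
    rw [hg, hf]
  inv_mem' := by
    intro f hf x y
    apply f.injective
    show f (f.symm (crossI x y)) = f (crossI (f.symm x) (f.symm y))
    rw [hf, f.apply_symm_apply, f.apply_symm_apply, f.apply_symm_apply]

open Octonion in
/-- (3) The subgroup `{g ∈ SO(7) : g*φ = φ}` of `SO(7)` preserving the associative
3-form `φ(x,y,z) = ⟨x × y, z⟩` on `Im 𝕆 ≅ ℝ⁷`: the inner-product-preserving linear
automorphisms of `Im 𝕆` of determinant one which preserve `φ`. -/
def G2inSO7 : Subgroup ((ImO : Submodule ℝ Octonion) ≃ₗ[ℝ] (ImO : Submodule ℝ Octonion)) where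
  carrier := {g |
    (∀ x y : ImO, oinner (g x : Octonion) (g y : Octonion) = oinner (x : Octonion) y) ∧
    LinearMap.det (g : (ImO : Submodule ℝ Octonion) →ₗ[ℝ] (ImO : Submodule ℝ Octonion)) = 1 ∧
    ∀ x y z : ImO,
      oinner (cross (g x : Octonion) (g y : Octonion)) (g z : Octonion) =
        oinner (cross (x : Octonion) (y : Octonion)) (z : Octonion)}
  one_mem' := by
    refine ⟨fun _ _ => rfl, ?_, fun _ _ _ => rfl⟩
    rw [LinearEquiv.coe_toLinearMap_one]
    exact LinearMap.det_id
  mul_mem' := by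
    intro a b ha hb
    refine ⟨fun x y => ?_, ?_, fun x y z => ?_⟩
    · show oinner ((a (b x) : Octonion)) ((a (b y) : Octonion)) = _
      rw [ha.1, hb.1]
    · rw [LinearEquiv.coe_toLinearMap_mul, Module.End.mul_eq_comp, LinearMap.det_comp,
        ha.2.1, hb.2.1, one_mul]
    · show oinner (cross ((a (b x) : Octonion)) ((a (b y) : Octonion))) ((a (b z) : Octonion)) = _
      rw [ha.2.2, hb.2.2]
  inv_mem' := by
    intro a ha
    refine ⟨fun x y => ?_, ?_, fun x y z => ?_⟩
    · show oinner ((a.symm x : Octonion)) ((a.symm y : Octonion)) = _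
      have := ha.1 (a.symm x) (a.symm y)
      rw [a.apply_symm_apply, a.apply_symm_apply] at this
      exact this.symm
    · have hcomp : LinearEquiv.toLinearMap (a⁻¹ * a) =
          LinearEquiv.toLinearMap (1 : ↥ImO ≃ₗ[ℝ] ↥ImO) := by
        rw [inv_mul_cancel]
      rw [LinearEquiv.coe_toLinearMap_mul, LinearEquiv.coe_toLinearMap_one] at hcomp
      have hdet := congrArg LinearMap.det hcomp
      rw [Module.End.mul_eq_comp, LinearMap.det_comp, ha.2.1, mul_one, LinearMap.det_id]
        at hdet
      exact hdet
    · show oinner (cross ((a.symm x : Octonion)) ((a.symm y : Octonion)))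
          ((a.symm z : Octonion)) = _
      have := ha.2.2 (a.symm x) (a.symm y) (a.symm z)
      rw [a.apply_symm_apply, a.apply_symm_apply, a.apply_symm_apply] at this
      exact this.symm

/-- The linear automorphisms of `𝕆` with the topology induced from maps `𝕆 → 𝕆`. -/
instance : TopologicalSpace (Octonion ≃ₗ[ℝ] Octonion) :=
  TopologicalSpace.induced (fun g => (g : Octonion → Octonion)) inferInstance

section
open Set Topology unitInterval

theorem homotopic_of_mem {X : Type*} [TopologicalSpace X] {A : Set X} (sA : IsSimplyConnected A)
    {x y : X} (p q : Path x y) (hp : ∀ t, p t ∈ A) (hq : ∀ t, q t ∈ A) : p.Homotopic q := by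
  have := sA.simplyConnectedSpace
  have hx : x ∈ A := by simpa using hp 0
  have hy : y ∈ A := by simpa using hp 1
  let p' : Path (⟨x, hx⟩ : A) ⟨y, hy⟩ :=
    { toFun := fun t => ⟨p t, hp t⟩
      source' := by simp
      target' := by simp }
  let q' : Path (⟨x, hx⟩ : A) ⟨y, hy⟩ :=
    { toFun := fun t => ⟨q t, hq t⟩
      source' := by simp
      target' := by simp }
  have h := SimplyConnectedSpace.paths_homotopic p' q'
  exact h.map ⟨Subtype.val, continuous_subtype_val⟩

theorem path_trans_mem {X : Type*} [TopologicalSpace X] {A : Set X} {x y z : X} (p : Path x y)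
    (q : Path y z) (hp : ∀ t, p t ∈ A) (hq : ∀ t, q t ∈ A) : ∀ t, p.trans q t ∈ A := by
  have := Path.trans_range p q
  intro t
  have h : p.trans q t ∈ range p ∪ range q := this ▸ mem_range_self t
  rcases h with ⟨s, hs⟩ | ⟨s, hs⟩
  · exact hs ▸ hp s
  · exact hs ▸ hq s

theorem simplyConnected_of_cover {X : Type*} [TopologicalSpace X] (A B : Set X) (hA : IsOpen A)
    (hB : IsOpen B) (hU : ∀ x, x ∈ A ∨ x ∈ B) (sA : IsSimplyConnected A)
    (sB : IsSimplyConnected B) (hAB : IsPathConnected (A ∩ B)) : SimplyConnectedSpace X := by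
  obtain ⟨x0, hx0, hj⟩ := hAB
  have jA : ∀ y ∈ A, ∃ p : Path x0 y, ∀ t, p t ∈ A := fun y hy => by
    obtain ⟨p, hp⟩ := sA.isPathConnected.joinedIn x0 hx0.1 y hy
    exact ⟨p, hp⟩
  have jB : ∀ y ∈ B, ∃ p : Path x0 y, ∀ t, p t ∈ B := fun y hy => by
    obtain ⟨p, hp⟩ := sB.isPathConnected.joinedIn x0 hx0.2 y hy
    exact ⟨p, hp⟩
  have hc : ∀ y, ∃ p : Path x0 y, (∀ t, p t ∈ A) ∨ (∀ t, p t ∈ B) := fun y => by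
    rcases hU y with h | h
    · obtain ⟨p, hp⟩ := jA y h; exact ⟨p, Or.inl hp⟩
    · obtain ⟨p, hp⟩ := jB y h; exact ⟨p, Or.inr hp⟩
  choose c hc using hc
  have cA : ∀ y (p : Path x0 y), (∀ t, p t ∈ A) → (c y).Homotopic p := by
    intro y p hp
    rcases hc y with h | h
    · exact homotopic_of_mem sA _ _ h hp
    · obtain ⟨r, hr⟩ := @hj y ⟨by simpa using hp 1, by simpa using h 1⟩
      exact (homotopic_of_mem sB _ r h fun t => (hr t).2).trans
        (homotopic_of_mem sA _ _ (fun t => (hr t).1) hp)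
  have cB : ∀ y (p : Path x0 y), (∀ t, p t ∈ B) → (c y).Homotopic p := by
    intro y p hp
    rcases hc y with h | h
    · obtain ⟨r, hr⟩ := @hj y ⟨by simpa using h 1, by simpa using hp 1⟩
      exact (homotopic_of_mem sA _ r h fun t => (hr t).1).trans
        (homotopic_of_mem sB _ _ (fun t => (hr t).2) hp)
    · exact homotopic_of_mem sB _ _ h hp
  have dA : ∀ {y z} (d : Path y z), (∀ t, d t ∈ A) → ((c y).trans d).Homotopic (c z) := by
    intro y z d hd
    obtain ⟨p, hp⟩ := jA y (by simpa using hd 0)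
    exact ((cA y p hp).hcomp (Path.Homotopic.refl d)).trans
      (cA z _ (path_trans_mem p d hp hd)).symm
  have dB : ∀ {y z} (d : Path y z), (∀ t, d t ∈ B) → ((c y).trans d).Homotopic (c z) := by
    intro y z d hd
    obtain ⟨p, hp⟩ := jB y (by simpa using hd 0)
    exact ((cB y p hp).hcomp (Path.Homotopic.refl d)).trans
      (cB z _ (path_trans_mem p d hp hd)).symm
  have key : ∀ {y z} (γ : Path y z), ((c y).trans γ).Homotopic (c z) := by
    intro y z γ
    obtain ⟨t, ht0, htm, ⟨n, hn⟩, hcov⟩ := exists_monotone_Icc_subset_open_cover_unitInterval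
      (c := fun b : Bool => γ ⁻¹' (if b then A else B))
      (by rintro (_ | _)
          · exact hB.preimage γ.continuous
          · exact hA.preimage γ.continuous)
      (by intro s _
          rcases hU (γ s) with h | h
          · exact mem_iUnion.2 ⟨true, by simpa using h⟩
          · exact mem_iUnion.2 ⟨false, by simpa using h⟩)
    have step : ∀ m, ((c (γ 0)).trans (γ.subpath 0 (t m))).Homotopic (c (γ (t m))) := by
      intro m
      induction m with
      | zero =>
        rw [ht0, Path.subpath_self]
        exact ⟨Path.Homotopy.transRefl _⟩
      | succ m ih =>
        have h1 : (γ.subpath 0 (t (m+1))).Homotopic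
            ((γ.subpath 0 (t m)).trans (γ.subpath (t m) (t (m+1)))) :=
          Path.Homotopic.symm ⟨Path.Homotopy.subpathTransSubpath γ 0 (t m) (t (m+1))⟩
        have h2 : ((c (γ (t m))).trans (γ.subpath (t m) (t (m+1)))).Homotopic
            (c (γ (t (m+1)))) := by
          obtain ⟨b, hb⟩ := hcov m
          have hr := Path.range_subpath_of_le γ _ _ (htm (Nat.le_succ m))
          have hm : ∀ s, γ.subpath (t m) (t (m+1)) s ∈ (if b then A else B) := by
            intro s
            have : γ.subpath (t m) (t (m+1)) s ∈ γ '' Icc (t m) (t (m+1)) :=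
              hr ▸ mem_range_self s
            obtain ⟨s', hs', h⟩ := this
            rw [← h]
            exact hb hs'
          cases b
          · exact dB _ (by simpa using hm)
          · exact dA _ (by simpa using hm)
        have h3 := (Path.Homotopic.refl (c (γ 0))).hcomp h1
        have h4 : ((c (γ 0)).trans ((γ.subpath 0 (t m)).trans
            (γ.subpath (t m) (t (m+1))))).Homotopic
            (((c (γ 0)).trans (γ.subpath 0 (t m))).trans (γ.subpath (t m) (t (m+1)))) :=
          Path.Homotopic.symm ⟨Path.Homotopy.transAssoc _ _ _⟩
        exact h3.trans (h4.trans ((ih.hcomp (Path.Homotopic.refl _)).trans h2))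
    have h1 := step n
    rw [hn n le_rfl, Path.subpath_zero_one] at h1
    have gen : ∀ a b (ha : a = y) (hb : b = z), ((c a).trans (γ.cast ha hb)).Homotopic (c b) →
        ((c y).trans γ).Homotopic (c z) := by
      intro a b ha hb h; subst ha; subst hb; exact h
    exact gen _ _ _ _ h1
  rw [simply_connected_iff_paths_homotopic']
  refine ⟨⟨⟨x0⟩, fun x y => ⟨(c x).symm.trans (c y)⟩⟩, fun {x y} p q => ?_⟩
  have h := (key p).trans (key q).symm
  rw [← Path.Homotopic.Quotient.eq] at h ⊢
  simp only [Path.Homotopic.Quotient.mk_trans] at h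
  have h2 := congrArg (Path.Homotopic.Quotient.trans
    (Path.Homotopic.Quotient.symm (Path.Homotopic.Quotient.mk (c x)))) h
  simpa [← Path.Homotopic.Quotient.trans_assoc] using h2

end

section
open Set Topology Metric

/-- Locally Euclidean of dimension `n`. -/
def LocEuc (n : ℕ) (E : Type*) [TopologicalSpace E] : Prop :=
  ∀ x : E, ∃ e : OpenPartialHomeomorph E (EuclideanSpace ℝ (Fin n)), x ∈ e.source

theorem LocEuc.chartedSpace {n : ℕ} {E : Type*} [TopologicalSpace E] (h : LocEuc n E) :
    Nonempty (ChartedSpace (EuclideanSpace ℝ (Fin n)) E) := by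
  choose e he using h
  exact ⟨{ atlas := range e
           chartAt := e
           mem_chart_source := he
           chart_mem_atlas := fun x => mem_range_self x }⟩

section
variable {V : Type*} [NormedAddCommGroup V] [InnerProductSpace ℝ V]

theorem sphere_compl_contractible [FiniteDimensional ℝ V] (v : sphere (0 : V) 1) :
    ContractibleSpace ({v}ᶜ : Set (sphere (0 : V) 1)) := by
  have hv : ‖(v : V)‖ = 1 := by simp
  let e := stereographic hv
  have h1 : e.source = {v}ᶜ := stereographic_source hv
  have h2 : e.target = univ := stereographic_target hv
  have h : e.source ≃ₜ (Submodule.span ℝ {(v : V)})ᗮ :=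
    e.toHomeomorphSourceTarget.trans ((Homeomorph.setCongr h2).trans (Homeomorph.Set.univ _))
  exact ((Homeomorph.setCongr h1).symm.trans h).contractibleSpace

theorem sphere_compl_pair_pathConnected [FiniteDimensional ℝ V] (hd : 3 ≤ Module.finrank ℝ V)
    (v w : sphere (0 : V) 1) (hvw : w ≠ v) :
    IsPathConnected ({v}ᶜ ∩ {w}ᶜ : Set (sphere (0 : V) 1)) := by
  have hv : ‖(v : V)‖ = 1 := by simp
  let e := stereographic hv
  have h1 : e.source = {v}ᶜ := stereographic_source hv
  have h2 : e.target = univ := stereographic_target hv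
  have hfr : Module.finrank ℝ (Submodule.span ℝ {(v : V)})ᗮ + 1 = Module.finrank ℝ V := by
    have := Submodule.finrank_add_finrank_orthogonal (Submodule.span ℝ {(v : V)})
    rw [finrank_span_singleton (by intro h; simp [h] at hv)] at this
    omega
  have hr : 1 < Module.rank ℝ (Submodule.span ℝ {(v : V)})ᗮ := by
    rw [← Module.finrank_eq_rank]
    exact_mod_cast (by omega : 1 < Module.finrank ℝ (Submodule.span ℝ {(v : V)})ᗮ)
  have hp := isPathConnected_compl_singleton_of_one_lt_rank hr (e w)
  have hw : w ∈ e.source := by rw [h1]; simpa using hvw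
  have : ({v}ᶜ ∩ {w}ᶜ : Set (sphere (0 : V) 1)) = e.symm '' {e w}ᶜ := by
    ext x
    constructor
    · rintro ⟨hx, hxw⟩
      rw [← h1] at hx
      refine ⟨e x, ?_, e.left_inv hx⟩
      intro h
      exact hxw (e.injOn hx hw h)
    · rintro ⟨y, hy, rfl⟩
      have hyt : y ∈ e.target := by rw [h2]; trivial
      refine ⟨?_, ?_⟩
      · rw [← h1]; exact e.map_target hyt
      · intro h
        apply hy
        have h' : e.symm y = w := h
        rw [mem_singleton_iff, ← h', e.right_inv hyt]
  rw [this]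
  exact hp.image' (e.continuousOn_symm.mono (by rw [h2]; exact subset_univ _))

theorem exists_sphere_point [FiniteDimensional ℝ V] (hd : 3 ≤ Module.finrank ℝ V) :
    Nonempty (sphere (0 : V) 1) := by
  have : Nontrivial V := Module.nontrivial_of_finrank_pos (R := ℝ) (by omega)
  obtain ⟨x, hx⟩ := exists_norm_eq V (zero_le_one)
  exact ⟨⟨x, by simpa using hx⟩⟩

theorem simplyConnected_prod_of_contractible {U F : Type*} [TopologicalSpace U]
    [TopologicalSpace F] [ContractibleSpace U] [SimplyConnectedSpace F] :
    SimplyConnectedSpace (U × F) := by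
  obtain ⟨e⟩ := ContractibleSpace.hequiv U Unit
  exact ((e.prodCongr (ContinuousMap.HomotopyEquiv.refl F)).trans
    (Homeomorph.punitProd F).toHomotopyEquiv).simplyConnectedSpace

/-- Local triviality of `p : E → S(V)` over complements of points. -/
def SphereTriv {E : Type*} [TopologicalSpace E] (F : Type*) [TopologicalSpace F]
    (p : E → sphere (0 : V) 1) : Prop :=
  ∀ v : sphere (0 : V) 1, ∃ e : OpenPartialHomeomorph E (sphere (0 : V) 1 × F),
    e.source = {x | p x ≠ v} ∧ e.target = {v}ᶜ ×ˢ univ ∧ ∀ x, p x ≠ v → (e x).1 = p x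

theorem SphereTriv.simplyConnected [FiniteDimensional ℝ V] (hd : 3 ≤ Module.finrank ℝ V)
    {E F : Type*} [TopologicalSpace E] [TopologicalSpace F] [SimplyConnectedSpace F]
    {p : E → sphere (0 : V) 1} (h : SphereTriv F p) : SimplyConnectedSpace E := by
  obtain ⟨v⟩ := exists_sphere_point hd
  have hne : -v ≠ v := (ne_neg_of_mem_unit_sphere ℝ v).symm
  have sc : ∀ v, IsSimplyConnected {x | p x ≠ v} ∧ IsOpen {x | p x ≠ v} := by
    intro v
    obtain ⟨e, hs, ht, -⟩ := h v
    rw [← hs]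
    refine ⟨?_, e.open_source⟩
    have := sphere_compl_contractible v
    have h1 : SimplyConnectedSpace (({v}ᶜ : Set (sphere (0 : V) 1)) × F) :=
      simplyConnected_prod_of_contractible
    have hh : e.source ≃ₜ ({v}ᶜ : Set (sphere (0 : V) 1)) × F :=
      e.toHomeomorphSourceTarget.trans ((Homeomorph.setCongr ht).trans
        ((Homeomorph.Set.prod _ _).trans ((Homeomorph.refl _).prodCongr (Homeomorph.Set.univ F))))
    exact hh.toHomotopyEquiv.simplyConnectedSpace
  refine simplyConnected_of_cover _ _ (sc v).2 (sc (-v)).2 ?_ (sc v).1 (sc (-v)).1 ?_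
  · intro x
    by_cases hx : p x = v
    · right; intro h'; exact hne (h'.symm.trans hx)
    · left; exact hx
  · obtain ⟨e, hs, ht, he⟩ := h v
    have hpc := (sphere_compl_pair_pathConnected hd v (-v) hne).prod
      (isPathConnected_univ (X := F))
    have : ({x | p x ≠ v} ∩ {x | p x ≠ -v}) = e.symm '' (({v}ᶜ ∩ {-v}ᶜ) ×ˢ univ) := by
      ext x
      constructor
      · rintro ⟨hx, hx'⟩
        refine ⟨e x, ⟨⟨?_, ?_⟩, trivial⟩, e.left_inv (by rw [hs]; exact hx)⟩
        · rw [he x hx]; exact hx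
        · rw [he x hx]; exact hx'
      · rintro ⟨y, ⟨⟨hy1, hy2⟩, -⟩, rfl⟩
        have hyt : y ∈ e.target := by rw [ht]; exact ⟨hy1, trivial⟩
        have hys := e.map_target hyt
        rw [hs] at hys
        refine ⟨hys, ?_⟩
        have h3 := he _ hys
        rw [e.right_inv hyt] at h3
        show p (e.symm y) ≠ -v
        rw [← h3]; exact hy2
    rw [this]
    refine hpc.image' (e.continuousOn_symm.mono ?_)
    rw [ht]
    exact prod_mono inter_subset_left subset_rfl

theorem SphereTriv.locEuc {n m k : ℕ} [Fact (Module.finrank ℝ V = n + 1)]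
    {E F : Type*} [TopologicalSpace E] [TopologicalSpace F] (hF : LocEuc m F) (hk : n + m = k)
    {p : E → sphere (0 : V) 1} (h : SphereTriv F p) : LocEuc k E := by
  intro x
  obtain ⟨e, hs, ht, he⟩ := h (-p x)
  have hx : p x ≠ -p x := ne_neg_of_mem_unit_sphere ℝ _
  obtain ⟨c, hc⟩ := hF (e x).2
  let d := chartAt (EuclideanSpace ℝ (Fin n)) (e x).1
  let L : (EuclideanSpace ℝ (Fin n) × EuclideanSpace ℝ (Fin m)) ≃L[ℝ] EuclideanSpace ℝ (Fin k) :=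
    ContinuousLinearEquiv.ofFinrankEq (by simp [hk])
  refine ⟨(e.trans (d.prod c)).trans L.toHomeomorph.toOpenPartialHomeomorph, ?_⟩
  have hx' : x ∈ e.source := by rw [hs]; exact hx
  simp only [OpenPartialHomeomorph.trans_source, Homeomorph.toOpenPartialHomeomorph_source,
    preimage_univ, inter_univ, OpenPartialHomeomorph.prod_source]
  exact ⟨hx', mem_chart_source _ _, hc⟩

theorem sphere_simplyConnected [FiniteDimensional ℝ V] (hd : 3 ≤ Module.finrank ℝ V) :
    SimplyConnectedSpace (sphere (0 : V) 1) := by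
  refine SphereTriv.simplyConnected (F := Unit) (p := id) hd ?_
  intro v
  refine ⟨(Homeomorph.prodPUnit _).symm.toOpenPartialHomeomorph.restr {v}ᶜ, ?_, ?_, ?_⟩
  · simp; rfl
  · ext y
    simp
  · intro x _
    rfl

end

/-- The bundle `G → S(V)` from a group with a subgroup `H` and local sections. -/
theorem sphereTriv_of_sections {V : Type*} [NormedAddCommGroup V]
    {G : Type*} [Group G] [TopologicalSpace G] [IsTopologicalGroup G] (H : Subgroup G)
    (p : G → sphere (0 : V) 1) (hcont : Continuous p)
    (hH : ∀ g h, p g = p h ↔ g⁻¹ * h ∈ H)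
    (hsec : ∀ v : sphere (0 : V) 1, ∃ s : sphere (0 : V) 1 → G, ContinuousOn s {v}ᶜ ∧
      ∀ w, w ≠ v → p (s w) = w) :
    SphereTriv H p := by
  intro v
  obtain ⟨s, hs, hsb⟩ := hsec v
  classical
  have hmem : ∀ g : G, p g ≠ v → (s (p g))⁻¹ * g ∈ H := by
    intro g hg
    rw [← hH, hsb _ hg]
  have hopen : IsOpen {g : G | p g ≠ v} :=
    (isOpen_compl_singleton (x := v)).preimage hcont
  have hps : ∀ w (h : H), w ≠ v → p (s w * h) = w := by
    intro w h hw
    have h1 := (hH (s w) (s w * h)).2 (by simp)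
    rw [← h1, hsb w hw]
  refine ⟨{ toFun := fun g => (p g, if h : p g ≠ v then ⟨_, hmem g h⟩ else 1)
            invFun := fun y => s y.1 * y.2
            source := {g | p g ≠ v}
            target := {v}ᶜ ×ˢ univ
            map_source' := ?_
            map_target' := ?_
            left_inv' := ?_
            right_inv' := ?_
            open_source := hopen
            open_target := isOpen_compl_singleton.prod isOpen_univ
            continuousOn_toFun := ?_
            continuousOn_invFun := ?_ }, rfl, rfl, fun x _ => rfl⟩
  · intro g hg
    exact ⟨hg, trivial⟩
  · rintro ⟨w, h⟩ hw
    show p (s w * h) ≠ v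
    rw [hps w h hw.1]
    exact hw.1
  · intro g hg
    have hg' : p g ≠ v := hg
    simp [hg']
  · rintro ⟨w, h⟩ hw
    have h2 : p (s w * h) = w := hps w h hw.1
    have h3 : w ≠ v := hw.1
    ext1
    · exact h2
    · simp only [h2]
      rw [dif_pos h3]
      ext1
      simp
  · refine hcont.continuousOn.prodMk ?_
    rw [Topology.IsInducing.subtypeVal.continuousOn_iff]
    have : ContinuousOn (fun g : G => (s (p g))⁻¹ * g) {g | p g ≠ v} := by
      refine ContinuousOn.mul (ContinuousOn.inv (hs.comp hcont.continuousOn ?_)) continuousOn_id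
      intro g hg
      exact hg
    refine this.congr ?_
    intro g hg
    have hg' : p g ≠ v := hg
    simp [hg']
  · refine ContinuousOn.mul (hs.comp continuousOn_fst ?_)
      (continuous_subtype_val.comp continuous_snd).continuousOn
    intro y hy
    exact hy.1

end

noncomputable section
namespace Octonion

@[ext] theorem oext {x y : Octonion} (h1 : x.1 = y.1) (h2 : x.2 = y.2) : x = y := Prod.ext h1 h2

theorem mul_fst (x y : Octonion) : (x * y).1 = x.1 * y.1 - y.2 * star x.2 := rfl
theorem mul_snd (x y : Octonion) : (x * y).2 = star x.1 * y.2 + y.1 * x.2 := rfl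
theorem star_fst (x : Octonion) : (star x).1 = star x.1 := rfl
theorem star_snd (x : Octonion) : (star x).2 = -x.2 := rfl
theorem one_fst : (1 : Octonion).1 = (1 : Quaternion ℝ) := rfl
theorem one_snd : (1 : Octonion).2 = (0 : Quaternion ℝ) := rfl
theorem zero_fst : (0 : Octonion).1 = (0 : Quaternion ℝ) := rfl
theorem zero_snd : (0 : Octonion).2 = (0 : Quaternion ℝ) := rfl
theorem add_fst (x y : Octonion) : (x + y).1 = x.1 + y.1 := rfl
theorem add_snd (x y : Octonion) : (x + y).2 = x.2 + y.2 := rfl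
theorem sub_fst (x y : Octonion) : (x - y).1 = x.1 - y.1 := rfl
theorem sub_snd (x y : Octonion) : (x - y).2 = x.2 - y.2 := rfl
theorem neg_fst (x : Octonion) : (-x).1 = -x.1 := rfl
theorem neg_snd (x : Octonion) : (-x).2 = -x.2 := rfl
theorem smul_fst (c : ℝ) (x : Octonion) : (c • x).1 = c • x.1 := rfl
theorem smul_snd (c : ℝ) (x : Octonion) : (c • x).2 = c • x.2 := rfl

instance instNonAssocRing : NonAssocRing Octonion :=
  { (inferInstance : AddCommGroup Octonion), (inferInstance : Mul Octonion),
    (inferInstance : One Octonion) with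
    left_distrib := fun a b c => by
      apply oext
      · simp only [mul_fst, mul_snd, add_fst, add_snd, mul_add, add_mul]; abel
      · simp only [mul_fst, mul_snd, add_fst, add_snd, mul_add, add_mul]; abel
    right_distrib := fun a b c => by
      apply oext
      · simp only [mul_fst, mul_snd, add_fst, add_snd, mul_add, add_mul, star_add]; abel
      · simp only [mul_fst, mul_snd, add_fst, add_snd, mul_add, add_mul, star_add]; abel
    zero_mul := fun a => by apply oext <;> simp [mul_fst, mul_snd, zero_fst, zero_snd]
    mul_zero := fun a => by apply oext <;> simp [mul_fst, mul_snd, zero_fst, zero_snd]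
    one_mul := fun a => by apply oext <;> simp [mul_fst, mul_snd, one_fst, one_snd]
    mul_one := fun a => by apply oext <;> simp [mul_fst, mul_snd, one_fst, one_snd] }

instance : IsScalarTower ℝ Octonion Octonion :=
  ⟨fun c x y => by
    apply oext <;> simp [mul_fst, mul_snd, smul_fst, smul_snd, smul_sub, smul_add, star_smul]⟩

instance : SMulCommClass ℝ Octonion Octonion :=
  ⟨fun c x y => by
    apply oext <;> simp [mul_fst, mul_snd, smul_fst, smul_snd, smul_sub, smul_add, star_smul]⟩

theorem oinner_def' (x y : Octonion) : oinner x y =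
    x.1.re * y.1.re + x.1.imI * y.1.imI + x.1.imJ * y.1.imJ + x.1.imK * y.1.imK
    + x.2.re * y.2.re + x.2.imI * y.2.imI + x.2.imJ * y.2.imJ + x.2.imK * y.2.imK := by
  simp only [oinner, re, mul_fst, star_fst, star_snd, Quaternion.re_sub, Quaternion.re_mul,
    Quaternion.re_star, Quaternion.imI_star, Quaternion.imJ_star, Quaternion.imK_star,
    Quaternion.re_neg, Quaternion.imI_neg, Quaternion.imJ_neg, Quaternion.imK_neg]
  ring

theorem re_def' (x : Octonion) : re x = x.1.re := rfl

theorem lin1 (a b c : Octonion) :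
    a * (star b * c) + b * (star a * c) = (2 * oinner a b) • c := by
  apply oext <;> ext <;>
  simp only [oinner_def', mul_fst, mul_snd, star_fst, star_snd, add_fst, add_snd, smul_fst, smul_snd,
    Quaternion.re_sub, Quaternion.imI_sub, Quaternion.imJ_sub, Quaternion.imK_sub,
    Quaternion.re_add, Quaternion.imI_add, Quaternion.imJ_add, Quaternion.imK_add,
    Quaternion.re_mul, Quaternion.imI_mul, Quaternion.imJ_mul, Quaternion.imK_mul,
    Quaternion.re_smul, Quaternion.imI_smul, Quaternion.imJ_smul, Quaternion.imK_smul,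
    Quaternion.re_star, Quaternion.imI_star, Quaternion.imJ_star, Quaternion.imK_star,
    Quaternion.re_neg, Quaternion.imI_neg, Quaternion.imJ_neg, Quaternion.imK_neg, smul_eq_mul] <;>
  ring

theorem lin2 (a b c : Octonion) :
    (c * star b) * a + (c * star a) * b = (2 * oinner a b) • c := by
  apply oext <;> ext <;>
  simp only [oinner_def', mul_fst, mul_snd, star_fst, star_snd, add_fst, add_snd, smul_fst, smul_snd,
    Quaternion.re_sub, Quaternion.imI_sub, Quaternion.imJ_sub, Quaternion.imK_sub,
    Quaternion.re_add, Quaternion.imI_add, Quaternion.imJ_add, Quaternion.imK_add,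
    Quaternion.re_mul, Quaternion.imI_mul, Quaternion.imJ_mul, Quaternion.imK_mul,
    Quaternion.re_smul, Quaternion.imI_smul, Quaternion.imJ_smul, Quaternion.imK_smul,
    Quaternion.re_star, Quaternion.imI_star, Quaternion.imJ_star, Quaternion.imK_star,
    Quaternion.re_neg, Quaternion.imI_neg, Quaternion.imJ_neg, Quaternion.imK_neg, smul_eq_mul] <;>
  ring

set_option maxHeartbeats 4000000 in
theorem moufang_mid (z p q : Octonion) : (z * p) * (q * z) = (z * (p * q)) * z := by
  apply oext <;> ext <;>
  simp only [mul_fst, mul_snd,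
    Quaternion.re_sub, Quaternion.imI_sub, Quaternion.imJ_sub, Quaternion.imK_sub,
    Quaternion.re_add, Quaternion.imI_add, Quaternion.imJ_add, Quaternion.imK_add,
    Quaternion.re_mul, Quaternion.imI_mul, Quaternion.imJ_mul, Quaternion.imK_mul,
    Quaternion.re_star, Quaternion.imI_star, Quaternion.imJ_star, Quaternion.imK_star] <;>
  ring

set_option maxHeartbeats 4000000 in
theorem moufang_right (x a y : Octonion) : ((x * a) * y) * a = x * ((a * y) * a) := by
  apply oext <;> ext <;>
  simp only [mul_fst, mul_snd,
    Quaternion.re_sub, Quaternion.imI_sub, Quaternion.imJ_sub, Quaternion.imK_sub,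
    Quaternion.re_add, Quaternion.imI_add, Quaternion.imJ_add, Quaternion.imK_add,
    Quaternion.re_mul, Quaternion.imI_mul, Quaternion.imJ_mul, Quaternion.imK_mul,
    Quaternion.re_star, Quaternion.imI_star, Quaternion.imJ_star, Quaternion.imK_star] <;>
  ring
end Octonion

end

noncomputable section
namespace Octonion
open scoped Quaternion

theorem ostar_mul (a b : Octonion) : star (a * b) = star b * star a := by
  apply oext <;> ext <;>
  simp [mul_fst, mul_snd, star_fst, star_snd]

theorem ostar_star (a : Octonion) : star (star a) = a := by
  apply oext <;> simp [star_fst, star_snd]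

theorem oinner_comm (a b : Octonion) : oinner a b = oinner b a := by
  simp only [oinner_def']; ring
theorem oinner_add_left (a b c : Octonion) : oinner (a + b) c = oinner a c + oinner b c := by
  simp only [oinner_def', add_fst, add_snd, Quaternion.re_add, Quaternion.imI_add,
    Quaternion.imJ_add, Quaternion.imK_add]; ring
theorem oinner_smul_left (r : ℝ) (a c : Octonion) : oinner (r • a) c = r * oinner a c := by
  simp only [oinner_def', smul_fst, smul_snd, Quaternion.re_smul, Quaternion.imI_smul,
    Quaternion.imJ_smul, Quaternion.imK_smul, smul_eq_mul]; ring
theorem oinner_add_right (a b c : Octonion) : oinner c (a + b) = oinner c a + oinner c b := by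
  rw [oinner_comm, oinner_add_left, oinner_comm a, oinner_comm b]
theorem oinner_smul_right (r : ℝ) (a c : Octonion) : oinner c (r • a) = r * oinner c a := by
  rw [oinner_comm, oinner_smul_left, oinner_comm]
theorem oinner_neg_left (a c : Octonion) : oinner (-a) c = -oinner a c := by
  rw [← neg_one_smul ℝ, oinner_smul_left]; ring
theorem oinner_neg_right (a c : Octonion) : oinner c (-a) = -oinner c a := by
  rw [← neg_one_smul ℝ, oinner_smul_right]; ring
theorem oinner_sub_left (a b c : Octonion) : oinner (a - b) c = oinner a c - oinner b c := by
  rw [sub_eq_add_neg, oinner_add_left, oinner_neg_left]; ring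
theorem oinner_sub_right (a b c : Octonion) : oinner c (a - b) = oinner c a - oinner c b := by
  rw [sub_eq_add_neg, oinner_add_right, oinner_neg_right]; ring
theorem oinner_zero_left (c : Octonion) : oinner 0 c = 0 := by simp [oinner_def', zero_fst, zero_snd]
theorem oinner_zero_right (c : Octonion) : oinner c 0 = 0 := by simp [oinner_def', zero_fst, zero_snd]

theorem oinner_one_left (a : Octonion) : oinner 1 a = re a := by
  simp [oinner_def', one_fst, one_snd, re_def']
theorem oinner_one_right (a : Octonion) : oinner a 1 = re a := by
  rw [oinner_comm, oinner_one_left]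

theorem oinner_self_nonneg (a : Octonion) : 0 ≤ oinner a a := by
  rw [oinner_def']
  nlinarith [sq_nonneg a.1.re, sq_nonneg a.1.imI,
    sq_nonneg a.1.imJ, sq_nonneg a.1.imK, sq_nonneg a.2.re, sq_nonneg a.2.imI,
    sq_nonneg a.2.imJ, sq_nonneg a.2.imK]

theorem oinner_self_eq_zero {a : Octonion} (h : oinner a a = 0) : a = 0 := by
  rw [oinner_def'] at h
  apply oext <;> ext <;> simp only [zero_fst, zero_snd, Quaternion.re_zero, Quaternion.imI_zero,
    Quaternion.imJ_zero, Quaternion.imK_zero] <;> nlinarith [sq_nonneg a.1.re, sq_nonneg a.1.imI,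
    sq_nonneg a.1.imJ, sq_nonneg a.1.imK, sq_nonneg a.2.re, sq_nonneg a.2.imI,
    sq_nonneg a.2.imJ, sq_nonneg a.2.imK]

theorem ostar_eq (a : Octonion) : star a = (2 * re a) • (1 : Octonion) - a := by
  apply oext <;> ext <;> simp [star_fst, star_snd, sub_fst, sub_snd, smul_fst, smul_snd, one_fst,
    one_snd, re_def'] <;> ring

theorem ostar_im {a : Octonion} (h : re a = 0) : star a = -a := by
  rw [ostar_eq, h]; simp

theorem re_ostar (a : Octonion) : re (star a) = re a := by simp [re_def', star_fst]
theorem re_add (a b : Octonion) : re (a + b) = re a + re b := by simp [re_def', add_fst]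
theorem re_sub (a b : Octonion) : re (a - b) = re a - re b := by simp [re_def', sub_fst]
theorem re_neg (a : Octonion) : re (-a) = -re a := by simp [re_def', neg_fst]
theorem re_smul (r : ℝ) (a : Octonion) : re (r • a) = r * re a := by simp [re_def', smul_fst]
theorem re_one : re 1 = 1 := by simp [re_def', one_fst]

theorem mul_ostar (a : Octonion) : a * star a = oinner a a • (1 : Octonion) := by
  have h := lin1 a a 1
  rw [mul_one, ← two_smul ℝ, mul_smul] at h
  exact smul_right_injective _ (two_ne_zero) h
theorem ostar_mul_self (a : Octonion) : star a * a = oinner a a • (1 : Octonion) := by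
  have h := lin2 a a 1
  rw [one_mul, ← two_smul ℝ, mul_smul] at h
  exact smul_right_injective _ (two_ne_zero) h

theorem mul_mul_im {a : Octonion} (h : re a = 0) (c : Octonion) :
    a * (a * c) = -(oinner a a • c) := by
  have h1 := lin1 a a c
  rw [ostar_im h, ← two_smul ℝ, mul_smul] at h1
  have h2 := smul_right_injective _ (two_ne_zero) h1
  simp only [neg_mul, mul_neg] at h2
  rw [← h2, neg_neg]
theorem mul_mul_im' {a : Octonion} (h : re a = 0) (c : Octonion) :
    (c * a) * a = -(oinner a a • c) := by
  have h1 := lin2 a a c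
  rw [ostar_im h, ← two_smul ℝ, mul_smul] at h1
  have h2 := smul_right_injective _ (two_ne_zero) h1
  simp only [neg_mul, mul_neg] at h2
  rw [← h2, neg_neg]
theorem mul_self_im {a : Octonion} (h : re a = 0) : a * a = -(oinner a a • (1 : Octonion)) := by
  simpa using mul_mul_im h 1
theorem mul_anticomm {a b : Octonion} (ha : re a = 0) (hb : re b = 0) :
    a * b + b * a = -((2 * oinner a b) • (1 : Octonion)) := by
  have h1 := lin1 a b 1
  rw [ostar_im ha, ostar_im hb] at h1
  rw [← h1]; simp; abel
theorem mul_anticomm' {a b : Octonion} (ha : re a = 0) (hb : re b = 0) (h : oinner a b = 0) :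
    b * a = -(a * b) := by
  have := mul_anticomm ha hb
  rw [h] at this
  simp only [mul_zero, zero_smul, neg_zero] at this
  rw [add_comm] at this
  exact eq_neg_of_add_eq_zero_left this
theorem re_mul_im {a b : Octonion} (hb : re b = 0) : re (a * b) = - oinner a b := by
  rw [oinner, ostar_im hb, mul_neg, re_neg, neg_neg]

theorem oinner_mul_left (a b c : Octonion) : oinner (a * b) c = oinner b (star a * c) := by
  simp only [oinner_def', mul_fst, mul_snd, star_fst, star_snd,
    Quaternion.re_sub, Quaternion.imI_sub, Quaternion.imJ_sub, Quaternion.imK_sub,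
    Quaternion.re_add, Quaternion.imI_add, Quaternion.imJ_add, Quaternion.imK_add,
    Quaternion.re_mul, Quaternion.imI_mul, Quaternion.imJ_mul, Quaternion.imK_mul,
    Quaternion.re_star, Quaternion.imI_star, Quaternion.imJ_star, Quaternion.imK_star,
    Quaternion.re_neg, Quaternion.imI_neg, Quaternion.imJ_neg, Quaternion.imK_neg]
  ring
theorem oinner_mul_right (a b c : Octonion) : oinner (a * b) c = oinner a (c * star b) := by
  simp only [oinner_def', mul_fst, mul_snd, star_fst, star_snd,
    Quaternion.re_sub, Quaternion.imI_sub, Quaternion.imJ_sub, Quaternion.imK_sub,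
    Quaternion.re_add, Quaternion.imI_add, Quaternion.imJ_add, Quaternion.imK_add,
    Quaternion.re_mul, Quaternion.imI_mul, Quaternion.imJ_mul, Quaternion.imK_mul,
    Quaternion.re_star, Quaternion.imI_star, Quaternion.imJ_star, Quaternion.imK_star,
    Quaternion.re_neg, Quaternion.imI_neg, Quaternion.imJ_neg, Quaternion.imK_neg]
  ring
theorem oinner_mul_mul_left (a b c : Octonion) :
    oinner (a * b) (a * c) = oinner a a * oinner b c := by
  have h1 := lin1 (star a) (star a) c
  rw [ostar_star, ← two_smul ℝ, mul_smul] at h1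
  have h2 : star a * (a * c) = _ := smul_right_injective _ (two_ne_zero) h1
  have h3 : oinner (star a) (star a) = oinner a a := by
    simp [oinner_def', star_fst, star_snd]
  rw [oinner_mul_left]
  rw [h2, oinner_smul_right, h3]

/-- Basic triples. -/
structure BT (x y z : Octonion) : Prop where
  rx : re x = 0
  ry : re y = 0
  rz : re z = 0
  nx : oinner x x = 1
  ny : oinner y y = 1
  nz : oinner z z = 1
  xy : oinner x y = 0
  xz : oinner x z = 0
  yz : oinner y z = 0
  xyz : oinner (x * y) z = 0

def iota (x y : Octonion) (a : Quaternion ℝ) : Octonion :=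
  a.re • (1 : Octonion) + a.imI • x + a.imJ • y + a.imK • (x * y)

theorem iota_add (x y : Octonion) (a b : Quaternion ℝ) :
    iota x y (a + b) = iota x y a + iota x y b := by
  simp only [iota, Quaternion.re_add, Quaternion.imI_add, Quaternion.imJ_add, Quaternion.imK_add]
  module
theorem iota_smul (x y : Octonion) (r : ℝ) (b : Quaternion ℝ) :
    iota x y (r • b) = r • iota x y b := by
  simp only [iota, Quaternion.re_smul, Quaternion.imI_smul, Quaternion.imJ_smul,
    Quaternion.imK_smul, smul_eq_mul]
  module
theorem iota_sub (x y : Octonion) (a b : Quaternion ℝ) :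
    iota x y (a - b) = iota x y a - iota x y b := by
  simp only [iota, Quaternion.re_sub, Quaternion.imI_sub, Quaternion.imJ_sub, Quaternion.imK_sub]
  module

theorem iota_mul {x y : Octonion} (rx : re x = 0) (ry : re y = 0) (nx : oinner x x = 1)
    (ny : oinner y y = 1) (hxy : oinner x y = 0) (a b : Quaternion ℝ) :
    iota x y (a * b) = iota x y a * iota x y b := by
  have h1 : x * x = -1 := by rw [mul_self_im rx, nx, one_smul]
  have h2 : y * y = -1 := by rw [mul_self_im ry, ny, one_smul]
  have h3 : y * x = -(x * y) := mul_anticomm' rx ry hxy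
  have h4 : x * (x * y) = -y := by rw [mul_mul_im rx, nx, one_smul]
  have h5 : (x * y) * y = -x := by rw [mul_mul_im' ry, ny, one_smul]
  have h6 : (x * y) * x = y := by
    rw [← neg_neg (x * y), ← h3, neg_mul, mul_mul_im' rx, nx, one_smul, neg_neg]
  have h7 : y * (x * y) = x := by
    rw [← neg_neg (x * y), ← h3, mul_neg, mul_mul_im ry, ny, one_smul, neg_neg]
  have h8 : (x * y) * (x * y) = -1 := by
    rw [mul_self_im (by rw [re_mul_im ry, hxy, neg_zero]), oinner_mul_mul_left, nx, ny]
    simp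
  simp only [iota, mul_add, add_mul, smul_mul_assoc, mul_smul_comm, h1, h2, h3, h4, h5, h6, h7, h8,
    Quaternion.re_mul, Quaternion.imI_mul, Quaternion.imJ_mul, Quaternion.imK_mul, one_mul,
    mul_one]
  module

theorem iota_star {x y : Octonion} (rx : re x = 0) (ry : re y = 0)
    (hxy : oinner x y = 0) (a : Quaternion ℝ) :
    iota x y (star a) = star (iota x y a) := by
  have h : re (x * y) = 0 := by rw [re_mul_im ry, hxy, neg_zero]
  rw [ostar_eq]
  simp only [iota, re_add, re_smul, re_one, rx, ry, h, Quaternion.re_star, Quaternion.imI_star,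
    Quaternion.imJ_star, Quaternion.imK_star]
  module

theorem BT.iota_perp {x y z : Octonion} (h : BT x y z) (a : Quaternion ℝ) :
    oinner (iota x y a) z = 0 := by
  simp only [iota, oinner_add_left, oinner_smul_left, oinner_one_left, h.rz, h.xz, h.yz, h.xyz]
  ring

def mkT (x y z w : Octonion) : Octonion := iota x y w.1 + z * iota x y w.2

theorem cd1 {a z d : Octonion} (hz : re z = 0) (h : oinner a z = 0) :
    a * (z * d) = z * (star a * d) := by
  have h1 := lin1 a z d
  rw [h, ostar_im hz] at h1
  simp only [neg_mul, mul_neg, mul_zero, zero_smul] at h1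
  exact (neg_add_eq_zero.1 h1)
theorem cd0 {a z : Octonion} (hz : re z = 0) (h : oinner (star a) z = 0) :
    z * a = star a * z := by
  have := cd1 (a := star a) (d := 1) hz h
  simpa [ostar_star] using this.symm
theorem cd2 {b c z : Octonion} (hz : re z = 0) (hb : oinner (star b) z = 0)
    (hc : oinner c z = 0) (hcb : oinner (star (c * b)) z = 0) :
    (z * b) * c = z * (c * b) := by
  have h1 := lin2 c z (star b)
  rw [hc, ostar_im hz] at h1
  simp only [neg_mul, mul_neg, mul_zero, zero_smul] at h1
  rw [cd0 hz hb, cd0 hz hcb, ostar_mul]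
  exact (neg_add_eq_zero.1 h1)
theorem cd3 {b d z : Octonion} (hz : re z = 0) (nz : oinner z z = 1)
    (hd : oinner (star d) z = 0) (hcb : oinner (star (b * star d)) z = 0) :
    (z * b) * (z * d) = -(d * star b) := by
  rw [cd0 hz hd, moufang_mid, cd0 hz hcb, mul_mul_im' hz, nz, one_smul, ostar_mul, ostar_star]

theorem mkT_mul {x y z : Octonion} (h : BT x y z) (v w : Octonion) :
    mkT x y z (v * w) = mkT x y z v * mkT x y z w := by
  have hm := iota_mul h.rx h.ry h.nx h.ny h.xy
  have hs := iota_star h.rx h.ry h.xy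
  have hp := h.iota_perp
  simp only [mkT, mul_fst, mul_snd, iota_add, iota_sub, hm, mul_add, add_mul]
  rw [cd1 (a := iota x y v.1) h.rz (hp _),
    cd2 (b := iota x y v.2) h.rz (by rw [← hs]; exact hp _) (hp _)
      (by rw [← hm, ← hs]; exact hp _),
    cd3 (b := iota x y v.2) h.rz h.nz (by rw [← hs]; exact hp _)
      (by rw [← hs, ← hm, ← hs]; exact hp _)]
  simp only [hs]
  abel

def mkTL (x y z : Octonion) : Octonion →ₗ[ℝ] Octonion where
  toFun := mkT x y z
  map_add' v w := by
    simp only [mkT, add_fst, add_snd, iota_add, mul_add]; abel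
  map_smul' r v := by
    simp only [mkT, smul_fst, smul_snd, iota_smul, mul_smul_comm, smul_add, RingHom.id_apply]

theorem mkT_one (x y z : Octonion) : mkT x y z 1 = 1 := by
  simp [mkT, iota, one_fst, one_snd]

instance : FiniteDimensional ℝ Octonion :=
  inferInstanceAs (FiniteDimensional ℝ (Quaternion ℝ × Quaternion ℝ))

theorem mkTL_inj {x y z : Octonion} (h : BT x y z) : Function.Injective (mkTL x y z) := by
  rw [injective_iff_map_eq_zero]
  intro v hv
  have hv' : mkT x y z v = 0 := hv
  have h1 := mkT_mul h v (star v)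
  have h2 : mkTL x y z (v * star v) = oinner v v • mkTL x y z 1 := by
    rw [mul_ostar, map_smul]
  have h3 : mkTL x y z (v * star v) = 0 := by
    show mkT x y z _ = 0
    rw [h1, hv', zero_mul]
  have h4 : mkTL x y z 1 = 1 := mkT_one x y z
  rw [h3, h4] at h2
  apply oinner_self_eq_zero
  have := congrArg re h2.symm
  rw [re_smul, re_one, mul_one] at this
  exact this

/-- the automorphism attached to a basic triple -/
def triG (x y z : Octonion) (h : BT x y z) : G2 :=
  ⟨LinearEquiv.ofInjectiveEndo (mkTL x y z) (mkTL_inj h), fun v w => mkT_mul h v w⟩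

theorem triG_apply {x y z : Octonion} (h : BT x y z) (w : Octonion) :
    (triG x y z h).1 w = mkT x y z w := rfl

def oi : Octonion := ((⟨0, 1, 0, 0⟩ : Quaternion ℝ), (0 : Quaternion ℝ))
def oj : Octonion := ((⟨0, 0, 1, 0⟩ : Quaternion ℝ), (0 : Quaternion ℝ))
def ol : Octonion := ((0 : Quaternion ℝ), (1 : Quaternion ℝ))
theorem oi_re : oi.1.re = 0 := rfl
theorem oi_imI : oi.1.imI = 1 := rfl
theorem oi_imJ : oi.1.imJ = 0 := rfl
theorem oi_imK : oi.1.imK = 0 := rfl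
theorem oi_snd : oi.2 = (0 : Quaternion ℝ) := rfl
theorem oj_re : oj.1.re = 0 := rfl
theorem oj_imI : oj.1.imI = 0 := rfl
theorem oj_imJ : oj.1.imJ = 1 := rfl
theorem oj_imK : oj.1.imK = 0 := rfl
theorem oj_snd : oj.2 = (0 : Quaternion ℝ) := rfl
theorem ol_fst : ol.1 = (0 : Quaternion ℝ) := rfl
theorem ol_snd : ol.2 = (1 : Quaternion ℝ) := rfl

theorem mkT_oi (x y z : Octonion) : mkT x y z oi = x := by
  simp [mkT, iota, oi_re, oi_imI, oi_imJ, oi_imK, oi_snd]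
theorem mkT_oj (x y z : Octonion) : mkT x y z oj = y := by
  simp [mkT, iota, oj_re, oj_imI, oj_imJ, oj_imK, oj_snd]
theorem mkT_ol (x y z : Octonion) : mkT x y z ol = z := by
  simp [mkT, iota, ol_fst, ol_snd]
theorem mkT_std (w : Octonion) : mkT oi oj ol w = w := by
  apply oext <;> ext <;>
  simp [mkT, iota, ol_fst, ol_snd, oi_re, oi_imI, oi_imJ, oi_imK, oi_snd, oj_re, oj_imI, oj_imJ, oj_imK, oj_snd, mul_fst, mul_snd, add_fst,
    add_snd, smul_fst, smul_snd, one_fst, one_snd]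

theorem BT_std : BT oi oj ol := by
  constructor <;> simp [re_def', oinner_def', ol_fst, ol_snd, oi_re, oi_imI, oi_imJ, oi_imK, oi_snd, oj_re, oj_imI, oj_imJ, oj_imK, oj_snd,
    mul_fst, mul_snd]

section G2
variable (g : G2)

theorem g_mul (x y : Octonion) : g.1 (x * y) = g.1 x * g.1 y := g.2 x y

theorem g_one : g.1 1 = 1 := by
  have h := g_mul g (g.1.symm 1) 1
  simpa using h.symm

theorem re_of_sq {w : Octonion} {N : ℝ} (hN : 0 ≤ N) (h : w * w = -(N • (1 : Octonion))) :
    re w = 0 := by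
  by_contra hr
  have h1 : w * w = (2 * re w) • w - oinner w w • (1 : Octonion) := by
    rw [← mul_ostar, ostar_eq w, mul_sub, mul_smul_comm, mul_one]; abel
  rw [h1] at h
  have h2 : (2 * re w) • w = (oinner w w - N) • (1 : Octonion) := by
    rw [sub_smul, sub_eq_iff_eq_add] at *
    rw [h]; abel
  have h3 : w = ((2 * re w)⁻¹ * (oinner w w - N)) • (1 : Octonion) := by
    rw [mul_smul, ← h2, smul_smul, inv_mul_cancel₀ (by simpa using hr), one_smul]
  set t := (2 * re w)⁻¹ * (oinner w w - N)
  have h4 : re w = t := by rw [h3, re_smul, re_one, mul_one]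
  have h5 : oinner w w = t * t := by
    rw [h3, oinner_smul_left, oinner_smul_right, oinner_one_left, re_one]; ring
  have h6 := congrArg re h2
  rw [re_smul, re_smul, re_one, h4, h5] at h6
  rw [h4] at hr
  have : 0 < t * t := mul_self_pos.2 hr
  nlinarith

theorem g_im {x : Octonion} (hx : re x = 0) : re (g.1 x) = 0 := by
  apply re_of_sq (oinner_self_nonneg x)
  rw [← g_mul, mul_self_im hx, map_neg, map_smul, g_one]

theorem g_re (x : Octonion) : re (g.1 x) = re x := by
  have h1 : re (x - re x • (1 : Octonion)) = 0 := by rw [re_sub, re_smul, re_one]; ring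
  have h2 := g_im g h1
  rw [map_sub, map_smul, g_one, re_sub, re_smul, re_one] at h2
  linarith

theorem g_star (x : Octonion) : g.1 (star x) = star (g.1 x) := by
  rw [ostar_eq, ostar_eq, map_sub, map_smul, g_one, g_re]

theorem g_inner (x y : Octonion) : oinner (g.1 x) (g.1 y) = oinner x y := by
  rw [oinner, ← g_star, ← g_mul, g_re, oinner]

theorem g_BT {x y z : Octonion} (h : BT x y z) : BT (g.1 x) (g.1 y) (g.1 z) := by
  constructor
  · rw [g_re, h.rx]
  · rw [g_re, h.ry]
  · rw [g_re, h.rz]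
  · rw [g_inner, h.nx]
  · rw [g_inner, h.ny]
  · rw [g_inner, h.nz]
  · rw [g_inner, h.xy]
  · rw [g_inner, h.xz]
  · rw [g_inner, h.yz]
  · rw [← g_mul, g_inner, h.xyz]

theorem g_iota (x y : Octonion) (a : Quaternion ℝ) : g.1 (iota x y a) = iota (g.1 x) (g.1 y) a := by
  simp only [iota, map_add, map_smul, g_one, g_mul]

theorem g_mkT (x y z w : Octonion) : g.1 (mkT x y z w) = mkT (g.1 x) (g.1 y) (g.1 z) w := by
  simp only [mkT, map_add, g_iota, g_mul]

theorem g_eq_mkT (w : Octonion) : g.1 w = mkT (g.1 oi) (g.1 oj) (g.1 ol) w := by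
  conv_lhs => rw [← mkT_std w]
  rw [g_mkT]

theorem g_ext {g h : G2} (hh : ∀ w, g.1 w = h.1 w) : g = h :=
  Subtype.ext (LinearEquiv.ext hh)

theorem g_ext_BT {g h : G2} (hi : g.1 oi = h.1 oi) (hj : g.1 oj = h.1 oj) (hl : g.1 ol = h.1 ol) :
    g = h := g_ext fun w => by rw [g_eq_mkT, g_eq_mkT h, hi, hj, hl]

theorem g_mul_apply (g h : G2) (w : Octonion) : (g * h).1 w = g.1 (h.1 w) := rfl
theorem g_inv_apply (g : G2) (w : Octonion) : (g⁻¹).1 (g.1 w) = w := g.1.symm_apply_apply w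
theorem g_inv_apply' (g : G2) (w : Octonion) : g.1 ((g⁻¹).1 w) = w := g.1.apply_symm_apply w
theorem g_one_apply (w : Octonion) : (1 : G2).1 w = w := rfl

/-- transitivity on basic triples -/
theorem exists_g {x y z x' y' z' : Octonion} (h : BT x y z) (h' : BT x' y' z') :
    ∃ g : G2, g.1 x = x' ∧ g.1 y = y' ∧ g.1 z = z' := by
  refine ⟨triG x' y' z' h' * (triG x y z h)⁻¹, ?_, ?_, ?_⟩
  · have := g_inv_apply (triG x y z h) oi
    rw [triG_apply, mkT_oi] at this
    rw [g_mul_apply, this]; exact mkT_oi _ _ _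
  · have := g_inv_apply (triG x y z h) oj
    rw [triG_apply, mkT_oj] at this
    rw [g_mul_apply, this]; exact mkT_oj _ _ _
  · have := g_inv_apply (triG x y z h) ol
    rw [triG_apply, mkT_ol] at this
    rw [g_mul_apply, this]; exact mkT_ol _ _ _

theorem g_ext_BT' {x y z : Octonion} (hb : BT x y z) {g h : G2} (hi : g.1 x = h.1 x)
    (hj : g.1 y = h.1 y) (hl : g.1 z = h.1 z) : g = h := by
  obtain ⟨k, h1, h2, h3⟩ := exists_g BT_std hb
  have : g * k = h * k := by
    apply g_ext_BT <;> simp only [g_mul_apply, h1, h2, h3, hi, hj, hl]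
  exact mul_right_cancel this

end G2
end Octonion

end

noncomputable section
namespace Octonion
open scoped Quaternion

instance : IsTopologicalAddGroup Octonion :=
  inferInstanceAs (IsTopologicalAddGroup (Quaternion ℝ × Quaternion ℝ))
instance : ContinuousSMul ℝ Octonion :=
  inferInstanceAs (ContinuousSMul ℝ (Quaternion ℝ × Quaternion ℝ))
instance : T2Space Octonion :=
  inferInstanceAs (T2Space (Quaternion ℝ × Quaternion ℝ))

theorem cont_fst : Continuous (fun x : Octonion => x.1) := continuous_fst
theorem cont_snd : Continuous (fun x : Octonion => x.2) := continuous_snd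

theorem cont_mk {X : Type*} [TopologicalSpace X] {f g : X → Quaternion ℝ} (hf : Continuous f)
    (hg : Continuous g) : Continuous (fun x => ((f x, g x) : Octonion)) := hf.prodMk hg

instance : ContinuousMul Octonion := ⟨by
  have h1 : Continuous (fun p : Octonion × Octonion => p.1.1) := cont_fst.comp continuous_fst
  have h2 : Continuous (fun p : Octonion × Octonion => p.1.2) := cont_snd.comp continuous_fst
  have h3 : Continuous (fun p : Octonion × Octonion => p.2.1) := cont_fst.comp continuous_snd
  have h4 : Continuous (fun p : Octonion × Octonion => p.2.2) := cont_snd.comp continuous_snd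
  exact cont_mk ((h1.mul h3).sub (h4.mul h2.star)) ((h1.star.mul h4).add (h3.mul h2))⟩

instance : ContinuousStar Octonion := ⟨cont_mk cont_fst.star cont_snd.neg⟩

theorem cont_re : Continuous re := Quaternion.continuous_re.comp cont_fst

@[fun_prop] theorem cont_oinner {X : Type*} [TopologicalSpace X] {f g : X → Octonion}
    (hf : Continuous f) (hg : Continuous g) : Continuous (fun x => oinner (f x) (g x)) :=
  cont_re.comp (hf.mul hg.star)

@[fun_prop] theorem contOn_oinner {X : Type*} [TopologicalSpace X] {f g : X → Octonion} {s : Set X}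
    (hf : ContinuousOn f s) (hg : ContinuousOn g s) :
    ContinuousOn (fun x => oinner (f x) (g x)) s :=
  cont_re.comp_continuousOn (hf.mul hg.star)

theorem cont_iota {X : Type*} [TopologicalSpace X] {x y : X → Octonion} {a : X → Quaternion ℝ}
    (hx : Continuous x) (hy : Continuous y) (ha : Continuous a) :
    Continuous (fun t => iota (x t) (y t) (a t)) := by
  have h1 := Quaternion.continuous_re.comp ha
  have h2 := Quaternion.continuous_imI.comp ha
  have h3 := Quaternion.continuous_imJ.comp ha
  have h4 := Quaternion.continuous_imK.comp ha
  exact (((h1.smul continuous_const).add (h2.smul hx)).add (h3.smul hy)).add (h4.smul (hx.mul hy))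

theorem cont_mkT {X : Type*} [TopologicalSpace X] {x y z w : X → Octonion}
    (hx : Continuous x) (hy : Continuous y) (hz : Continuous z) (hw : Continuous w) :
    Continuous (fun t => mkT (x t) (y t) (z t) (w t)) :=
  (cont_iota hx hy (cont_fst.comp hw)).add (hz.mul (cont_iota hx hy (cont_snd.comp hw)))

theorem continuous_g2 {X : Type*} [TopologicalSpace X] {f : X → G2} :
    Continuous f ↔ ∀ w, Continuous (fun x => (f x).1 w) := by
  rw [Topology.IsInducing.subtypeVal.continuous_iff, continuous_induced_rng, continuous_pi_iff]
  rfl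

theorem continuousOn_g2 {X : Type*} [TopologicalSpace X] {f : X → G2} {s : Set X} :
    ContinuousOn f s ↔ ∀ w, ContinuousOn (fun x => (f x).1 w) s := by
  simp only [continuousOn_iff_continuous_domRestrict, continuous_g2]
  rfl

theorem cont_app (w : Octonion) : Continuous (fun g : G2 => g.1 w) := continuous_g2.1 continuous_id w

theorem cont_eval : Continuous (fun p : G2 × Octonion => p.1.1 p.2) := by
  have : (fun p : G2 × Octonion => p.1.1 p.2) =
      fun p => mkT (p.1.1 oi) (p.1.1 oj) (p.1.1 ol) p.2 := funext fun p => g_eq_mkT p.1 p.2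
  rw [this]
  exact cont_mkT ((cont_app _).comp continuous_fst) ((cont_app _).comp continuous_fst)
    ((cont_app _).comp continuous_fst) continuous_snd

theorem expand8 (y : Octonion) : y = oinner y 1 • (1 : Octonion) + oinner y oi • oi
    + oinner y oj • oj + oinner y (oi * oj) • (oi * oj) + oinner y ol • ol
    + oinner y (ol * oi) • (ol * oi) + oinner y (ol * oj) • (ol * oj)
    + oinner y (ol * (oi * oj)) • (ol * (oi * oj)) := by
  apply oext <;> ext <;>
  simp [oinner_def', ol_fst, ol_snd, oi_re, oi_imI, oi_imJ, oi_imK, oi_snd, oj_re, oj_imI, oj_imJ,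
    oj_imK, oj_snd, mul_fst, mul_snd, add_fst,
    add_snd, smul_fst, smul_snd, one_fst, one_snd]

theorem cont_of_oinner {X : Type*} [TopologicalSpace X] {f : X → Octonion}
    (h : ∀ c, Continuous (fun x => oinner (f x) c)) : Continuous f := by
  have : f = fun x => _ := funext fun x => expand8 (f x)
  rw [this]
  exact ((((((((h _).smul continuous_const).add ((h _).smul continuous_const)).add
    ((h _).smul continuous_const)).add ((h _).smul continuous_const)).add
    ((h _).smul continuous_const)).add ((h _).smul continuous_const)).add
    ((h _).smul continuous_const)).add ((h _).smul continuous_const)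

theorem g_inner_inv (g : G2) (x y : Octonion) : oinner ((g⁻¹).1 x) y = oinner x (g.1 y) := by
  rw [← g_inner g, g_inv_apply']

instance : IsTopologicalGroup G2 where
  continuous_mul := continuous_g2.2 fun w => by
    have h : Continuous (fun p : G2 × G2 => (p.1, p.2.1 w)) :=
      continuous_fst.prodMk ((cont_app w).comp continuous_snd)
    exact cont_eval.comp h
  continuous_inv := continuous_g2.2 fun w => cont_of_oinner fun c => by
    simp only [g_inner_inv]
    exact cont_oinner continuous_const (cont_app c)

theorem norm_bound {x : Octonion} (h : oinner x x = 1) :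
    norm (E := Quaternion ℝ × Quaternion ℝ) x ≤ 1 := by
  have h1 : oinner x x = ‖x.1‖ * ‖x.1‖ + ‖x.2‖ * ‖x.2‖ := by
    rw [← Quaternion.normSq_eq_norm_mul_self, ← Quaternion.normSq_eq_norm_mul_self,
      Quaternion.normSq_def', Quaternion.normSq_def', oinner_def']; ring
  rw [h1] at h
  apply max_le
  · nlinarith [norm_nonneg x.1, norm_nonneg x.2]
  · nlinarith [norm_nonneg x.1, norm_nonneg x.2]

theorem compact_unit : IsCompact {x : Octonion | oinner x x = 1} := by
  have hc : IsClosed {x : Octonion | oinner x x = 1} :=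
    isClosed_eq (cont_oinner continuous_id continuous_id) continuous_const
  have : IsCompact (Metric.closedBall (0 : Quaternion ℝ × Quaternion ℝ) 1) :=
    isCompact_closedBall _ _
  refine IsCompact.of_isClosed_subset (X := Octonion) this hc ?_
  intro x hx
  exact mem_closedBall_zero_iff.2 (norm_bound hx)

def BTset : Set (Octonion × Octonion × Octonion) := {t | BT t.1 t.2.1 t.2.2}

theorem compact_BTset : IsCompact BTset := by
  have hc : IsClosed BTset := by
    have h1 : Continuous (fun t : Octonion × Octonion × Octonion => t.1) := continuous_fst
    have h2 : Continuous (fun t : Octonion × Octonion × Octonion => t.2.1) := by fun_prop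
    have h3 : Continuous (fun t : Octonion × Octonion × Octonion => t.2.2) := by fun_prop
    have : BTset = {t | re t.1 = 0} ∩ {t | re t.2.1 = 0} ∩ {t | re t.2.2 = 0} ∩
      {t | oinner t.1 t.1 = 1} ∩ {t | oinner t.2.1 t.2.1 = 1} ∩ {t | oinner t.2.2 t.2.2 = 1} ∩
      {t | oinner t.1 t.2.1 = 0} ∩ {t | oinner t.1 t.2.2 = 0} ∩ {t | oinner t.2.1 t.2.2 = 0} ∩
      {t | oinner (t.1 * t.2.1) t.2.2 = 0} := by
      ext t
      constructor
      · rintro ⟨a, b, c, d, e, f, g, h, i, j⟩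
        exact ⟨⟨⟨⟨⟨⟨⟨⟨⟨a, b⟩, c⟩, d⟩, e⟩, f⟩, g⟩, h⟩, i⟩, j⟩
      · rintro ⟨⟨⟨⟨⟨⟨⟨⟨⟨a, b⟩, c⟩, d⟩, e⟩, f⟩, g⟩, h⟩, i⟩, j⟩
        exact ⟨a, b, c, d, e, f, g, h, i, j⟩
    rw [this]
    have r : ∀ {f : Octonion × Octonion × Octonion → Octonion} (_ : Continuous f),
      IsClosed {t | re (f t) = 0} := fun hf => isClosed_eq (cont_re.comp hf) continuous_const
    have q : ∀ {f g : Octonion × Octonion × Octonion → Octonion} (c : ℝ) (_ : Continuous f)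
      (_ : Continuous g),
      IsClosed {t | oinner (f t) (g t) = c} :=
        fun c hf hg => isClosed_eq (cont_oinner hf hg) continuous_const
    exact ((((((((((r h1).inter (r h2)).inter (r h3)).inter (q 1 h1 h1)).inter (q 1 h2 h2)).inter
      (q 1 h3 h3)).inter (q 0 h1 h2)).inter (q 0 h1 h3)).inter (q 0 h2 h3)).inter
      (q 0 (h1.mul h2) h3))
  refine IsCompact.of_isClosed_subset (compact_unit.prod (compact_unit.prod compact_unit)) hc ?_
  intro t ht
  exact ⟨ht.nx, ht.ny, ht.nz⟩

instance : CompactSpace G2 := by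
  have : CompactSpace BTset := isCompact_iff_compactSpace.1 compact_BTset
  have h : Continuous (fun t : BTset => triG t.1.1 t.1.2.1 t.1.2.2 t.2) := by
    refine continuous_g2.2 fun w => ?_
    exact cont_mkT (by fun_prop) (by fun_prop) (by fun_prop) continuous_const
  refine Function.Surjective.compactSpace (f := fun t : BTset => triG t.1.1 t.1.2.1 t.1.2.2 t.2) h ?_
  intro g
  refine ⟨⟨(g.1 oi, g.1 oj, g.1 ol), g_BT g BT_std⟩, ?_⟩
  exact g_ext fun w => (g_eq_mkT g w).symm

end Octonion

end

noncomputable section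
namespace Octonion
open scoped Quaternion

theorem finrank_oct : Module.finrank ℝ Octonion = 8 := by
  have : Module.finrank ℝ (Quaternion ℝ × Quaternion ℝ) = 8 := by
    rw [Module.finrank_prod, Quaternion.finrank_eq_four]
  exact this

/-- A unit vector orthogonal to seven given vectors. -/
theorem exists_perp (f : Fin 7 → Octonion) : ∃ z, oinner z z = 1 ∧ ∀ i, oinner (f i) z = 0 := by
  let L : Octonion →ₗ[ℝ] (Fin 7 → ℝ) :=
    { toFun := fun z i => oinner (f i) z
      map_add' := fun a b => by ext i; simp [oinner_add_right]
      map_smul' := fun a b => by ext i; simp [oinner_smul_right] }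
  have h : LinearMap.ker L ≠ ⊥ := by
    apply LinearMap.ker_ne_bot_of_finrank_lt
    rw [finrank_oct]; simp
  obtain ⟨z, hz, hz0⟩ := (Submodule.ne_bot_iff _).1 h
  have hp : 0 < oinner z z :=
    lt_of_le_of_ne (oinner_self_nonneg z) fun h => hz0 (oinner_self_eq_zero h.symm)
  refine ⟨(Real.sqrt (oinner z z))⁻¹ • z, ?_, fun i => ?_⟩
  · rw [oinner_smul_left, oinner_smul_right]
    have := Real.mul_self_sqrt hp.le
    have h2 : Real.sqrt (oinner z z) ≠ 0 := (Real.sqrt_pos.2 hp).ne'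
    field_simp
    nlinarith
  · rw [oinner_smul_right]
    have : oinner (f i) z = 0 := congrFun (LinearMap.mem_ker.1 hz) i
    rw [this, mul_zero]

theorem exists_BT2 {x y : Octonion} (rx : re x = 0) (ry : re y = 0) (nx : oinner x x = 1)
    (ny : oinner y y = 1) (xy : oinner x y = 0) : ∃ z, BT x y z := by
  obtain ⟨z, hz, h⟩ := exists_perp ![1, x, y, x * y, 0, 0, 0]
  have h0 := h 0
  have h1 := h 1
  have h2 := h 2
  have h3 := h 3
  simp at h0 h1 h2 h3
  rw [oinner_one_left] at h0
  exact ⟨z, rx, ry, h0, nx, ny, hz, xy, h1, h2, h3⟩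

theorem exists_BT1 {x : Octonion} (rx : re x = 0) (nx : oinner x x = 1) : ∃ y z, BT x y z := by
  obtain ⟨y, hy, h⟩ := exists_perp ![1, x, 0, 0, 0, 0, 0]
  have h0 := h 0
  have h1 := h 1
  simp at h0 h1
  rw [oinner_one_left] at h0
  exact ⟨y, exists_BT2 rx h0 nx hy h1⟩

theorem exists_g1 {x x' : Octonion} (rx : re x = 0) (nx : oinner x x = 1)
    (rx' : re x' = 0) (nx' : oinner x' x' = 1) : ∃ g : G2, g.1 x = x' := by
  obtain ⟨y, z, h⟩ := exists_BT1 rx nx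
  obtain ⟨y', z', h'⟩ := exists_BT1 rx' nx'
  obtain ⟨g, hg, -⟩ := exists_g h h'
  exact ⟨g, hg⟩

/-! conjugation by sixth roots of unity -/

theorem flex (z q : Octonion) : z * (q * z) = (z * q) * z := by
  simpa using moufang_mid z 1 q
theorem ralt (c a : Octonion) : (c * a) * a = c * (a * a) := by
  simpa using moufang_right c a 1
theorem mul_ostar_cancel (c a : Octonion) : (c * star a) * a = oinner a a • c := by
  have h := lin2 a a c
  rw [← two_smul ℝ, mul_smul] at h
  exact smul_right_injective _ (two_ne_zero) h
theorem mul_ostar_cancel' (c a : Octonion) : (c * a) * star a = oinner a a • c := by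
  have h3 : oinner (star a) (star a) = oinner a a := by
    simp [oinner_def', star_fst, star_snd]
  have := mul_ostar_cancel c (star a)
  rwa [ostar_star, h3] at this
theorem ostar_mul_cancel (c a : Octonion) : star a * (a * c) = oinner a a • c := by
  have h3 : oinner (star a) (star a) = oinner a a := by
    simp [oinner_def', star_fst, star_snd]
  have h := lin1 (star a) (star a) c
  rw [← two_smul ℝ, mul_smul, ostar_star, h3] at h
  exact smul_right_injective _ (two_ne_zero) h

def conjL (a : Octonion) : Octonion →ₗ[ℝ] Octonion where
  toFun x := a * (x * star a)
  map_add' v w := by simp only [add_mul, mul_add]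
  map_smul' r v := by simp only [smul_mul_assoc, mul_smul_comm, RingHom.id_apply]

theorem conjL_apply (a x : Octonion) : conjL a x = a * (x * star a) := rfl

theorem conjL_mul {a : Octonion} (hs : star a = 1 - a) (ha : oinner a a = 1) (x y : Octonion) :
    conjL a (x * y) = conjL a x * conjL a y := by
  have aa : a * a = - star a := by
    have := mul_ostar a
    rw [ha, one_smul, hs, mul_sub, mul_one] at this
    rw [hs, ← this]; abel
  have e1 : ∀ z, a * (z * star a) = (a * z) * star a := by
    intro z
    rw [hs, mul_sub, mul_sub, mul_one, mul_sub, mul_one, flex]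
  have e2 : ∀ z, a * (z * star a) = -(((a * z) * a) * a) := by
    intro z
    rw [e1, ralt, aa, mul_neg, neg_neg]
  rw [conjL_apply, conjL_apply, conjL_apply a y, e2 y, ← neg_mul, moufang_mid, mul_neg,
    ← moufang_right, mul_ostar_cancel, ha, one_smul, e2 (x * y), mul_neg, neg_mul, flex]

theorem conjL_inj {a : Octonion} (ha : oinner a a = 1) : Function.Injective (conjL a) := by
  rw [injective_iff_map_eq_zero]
  intro v hv
  rw [conjL_apply] at hv
  have h1 := ostar_mul_cancel (v * star a) a
  rw [hv, ha, one_smul, mul_zero] at h1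
  have h2 := mul_ostar_cancel v a
  rw [← h1, ha, one_smul, zero_mul] at h2
  exact h2.symm

def conjG (a : Octonion) (hs : star a = 1 - a) (ha : oinner a a = 1) : G2 :=
  ⟨LinearEquiv.ofInjectiveEndo (conjL a) (conjL_inj ha), fun v w => conjL_mul hs ha v w⟩

def au (u : Octonion) : Octonion := (1 / 2 : ℝ) • (1 : Octonion) + (Real.sqrt 3 / 2) • u

theorem sqrt3 : Real.sqrt 3 * Real.sqrt 3 = 3 := Real.mul_self_sqrt (by norm_num)

theorem au_star {u : Octonion} (h : re u = 0) : star (au u) = 1 - au u := by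
  rw [ostar_eq, au, re_add, re_smul, re_smul, h, re_one]; module
theorem au_norm {u : Octonion} (h : re u = 0) (hn : oinner u u = 1) : oinner (au u) (au u) = 1 := by
  simp only [au, oinner_add_left, oinner_add_right, oinner_smul_left, oinner_smul_right,
    oinner_one_left, oinner_one_right, re_add, re_smul, h, re_one, hn]
  nlinarith [sqrt3]

/-- the order three automorphism attached to a unit imaginary octonion -/
def cG (u : Octonion) (h : re u = 0) (hn : oinner u u = 1) : G2 :=
  conjG (au u) (au_star h) (au_norm h hn)

theorem cG_apply' {u : Octonion} (h : re u = 0) (hn : oinner u u = 1) (x : Octonion) :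
    (cG u h hn).1 x = au u * (x * star (au u)) := rfl

theorem cG_apply {u : Octonion} (h : re u = 0) (hn : oinner u u = 1) {x : Octonion}
    (hx : re x = 0) : (cG u h hn).1 x =
    (-(1 / 2) : ℝ) • x + (Real.sqrt 3 / 2) • (u * x + oinner u x • (1 : Octonion))
      + (3 / 2 * oinner u x) • u := by
  have h1 : x * u = -(u * x) - (2 * oinner u x) • (1 : Octonion) := by
    rw [sub_eq_add_neg, ← mul_anticomm h hx]; abel
  have h2 : u * (u * x) = -x := by rw [mul_mul_im h, hn, one_smul]
  rw [cG_apply', ostar_eq, au, re_add, re_smul, re_smul, h, re_one]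
  simp only [mul_add, add_mul, mul_sub, smul_mul_assoc, mul_smul_comm, one_mul, mul_one,
    h1, h2, mul_neg]
  have := sqrt3
  match_scalars
  · linear_combination (-1 / 4 : ℝ) * this
  · ring
  · ring
  · linear_combination (1 / 2 * oinner u x) * this

theorem oinner_mul_self_left (x y : Octonion) : oinner (x * y) x = oinner x x * re y := by
  have := oinner_mul_mul_left x y 1
  rwa [mul_one, oinner_one_right] at this
theorem oinner_mul_self_right (x y : Octonion) : oinner (x * y) y = oinner y y * re x := by
  rw [oinner_mul_right, mul_ostar, oinner_smul_right, oinner_one_right]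

/-- the axis of a rotation moving `x` to `y` -/
def uu (x y : Octonion) : Octonion :=
  (Real.sqrt 3 * (1 + oinner x y))⁻¹ • (Real.sqrt (1 + 2 * oinner x y) • (x + y)
    + (x * y + oinner x y • (1 : Octonion)))

theorem uu_re {x y : Octonion} (rx : re x = 0) (ry : re y = 0) : re (uu x y) = 0 := by
  simp only [uu, re_smul, re_add, rx, ry, re_mul_im ry, re_one]; ring

theorem uu_alpha {c : ℝ} (hc : -(1 / 2) < c) :
    (Real.sqrt 3 * (1 + c))⁻¹ * (Real.sqrt 3 * (1 + c)) = 1 := by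
  have h3 : Real.sqrt 3 ≠ 0 := (Real.sqrt_pos.2 (by norm_num)).ne'
  have : 1 + c ≠ 0 := by linarith
  exact inv_mul_cancel₀ (mul_ne_zero h3 this)

theorem uu_norm {x y : Octonion} (rx : re x = 0) (ry : re y = 0) (nx : oinner x x = 1)
    (ny : oinner y y = 1) (hc : -(1 / 2) < oinner x y) : oinner (uu x y) (uu x y) = 1 := by
  have e1 := oinner_mul_self_left x y
  have e2 := oinner_mul_self_right x y
  have e3 := oinner_mul_mul_left x y y
  rw [nx, ry] at e1
  rw [ny, rx] at e2
  rw [nx, ny] at e3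
  have hα := uu_alpha hc
  have hβ := Real.mul_self_sqrt (show 0 ≤ 1 + 2 * oinner x y by linarith)
  have hk := sqrt3
  unfold uu
  generalize (Real.sqrt 3 * (1 + oinner x y))⁻¹ = α at *
  generalize Real.sqrt (1 + 2 * oinner x y) = β at *
  generalize Real.sqrt 3 = k at *
  simp only [oinner_add_left, oinner_add_right, oinner_smul_left, oinner_smul_right,
    oinner_one_left, oinner_one_right, rx, ry, nx, ny, e1, e2, e3, re_mul_im ry, re_add, re_smul,
    re_one, oinner_comm x (x * y), oinner_comm y (x * y), oinner_comm y x]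
  generalize oinner x y = c at *
  linear_combination (2 * α ^ 2 * (1 + c)) * hβ - (α ^ 2 * (1 + c) ^ 2) * hk
    + (α * (k * (1 + c)) + 1) * hα

theorem cG_uu {x y : Octonion} (rx : re x = 0) (ry : re y = 0) (nx : oinner x x = 1)
    (ny : oinner y y = 1) (hc : -(1 / 2) < oinner x y) :
    (cG (uu x y) (uu_re rx ry) (uu_norm rx ry nx ny hc)).1 x = y := by
  rw [cG_apply _ _ rx]
  have e1 := oinner_mul_self_left x y
  rw [nx, ry] at e1
  have f1 : x * x = -1 := by rw [mul_self_im rx, nx, one_smul]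
  have f2 : y * x = -(x * y) - (2 * oinner x y) • (1 : Octonion) := by
    rw [sub_eq_add_neg, ← mul_anticomm rx ry]; abel
  have f3 : (x * y) * x = y - (2 * oinner x y) • x := by
    have : x * y = -(y * x) - (2 * oinner x y) • (1 : Octonion) := by
      rw [sub_eq_add_neg, ← mul_anticomm rx ry]; abel
    rw [this, sub_mul, neg_mul, mul_mul_im' rx, nx, one_smul, smul_mul_assoc, one_mul, neg_neg]
  have hα := uu_alpha hc
  have hβ := Real.mul_self_sqrt (show 0 ≤ 1 + 2 * oinner x y by linarith)
  have hk := sqrt3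
  unfold uu
  generalize (Real.sqrt 3 * (1 + oinner x y))⁻¹ = α at *
  generalize Real.sqrt (1 + 2 * oinner x y) = β at *
  generalize Real.sqrt 3 = k at *
  simp only [oinner_add_left, oinner_smul_left, oinner_one_left, rx, nx, e1, oinner_comm y x,
    add_mul, smul_mul_assoc, f1, f2, f3, one_mul]
  generalize oinner x y = c at *
  have hγ : 3 * α * (1 + c) = k := by linear_combination k * hα - α * (1 + c) * hk
  match_scalars
  · linear_combination (1 / 2 * α * β ^ 2) * hγ + (k * α / 2) * hβ + (1 / 2 : ℝ) * hα
  · linear_combination (1 / 2 * α * β * c) * hγ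
  · linear_combination (1 / 2 * α * β) * hγ
  · linear_combination (1 / 2 * α * β ^ 2) * hγ + (k * α / 2) * hβ + hα
end Octonion

end

noncomputable section
set_option linter.unusedSectionVars false
set_option linter.unusedSimpArgs false
namespace Octonion
open scoped Quaternion
open Metric

theorem oinner_lt {x y : Octonion} (nx : oinner x x = 1) (ny : oinner y y = 1) (h : y ≠ -x) :
    -1 < oinner x y := by
  have h1 : 0 < oinner (x + y) (x + y) :=
    lt_of_le_of_ne (oinner_self_nonneg _) fun h0 => h
      (eq_neg_of_add_eq_zero_right (oinner_self_eq_zero h0.symm))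
  simp only [oinner_add_left, oinner_add_right, nx, ny, oinner_comm y x] at h1
  linarith

/-- the midpoint -/
def mid (x y : Octonion) : Octonion := (Real.sqrt (2 + 2 * oinner x y))⁻¹ • (x + y)

theorem mid_norm {x y : Octonion} (nx : oinner x x = 1) (ny : oinner y y = 1)
    (h : -1 < oinner x y) : oinner (mid x y) (mid x y) = 1 := by
  have h1 : 0 < 2 + 2 * oinner x y := by linarith
  have h2 := Real.mul_self_sqrt h1.le
  have h3 : Real.sqrt (2 + 2 * oinner x y) ≠ 0 := (Real.sqrt_pos.2 h1).ne'
  simp only [mid, oinner_add_left, oinner_add_right, oinner_smul_left, oinner_smul_right, nx, ny,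
    oinner_comm y x]
  have h4 := inv_mul_cancel₀ h3
  generalize (Real.sqrt (2 + 2 * oinner x y))⁻¹ = i at *
  generalize Real.sqrt (2 + 2 * oinner x y) = k at *
  linear_combination (-i * i) * h2 + (i * k + 1) * h4
theorem mid_left {x y : Octonion} (nx : oinner x x = 1) (ny : oinner y y = 1)
    (h : -1 < oinner x y) : -(1 / 2) < oinner x (mid x y) := by
  have h1 : 0 < 2 + 2 * oinner x y := by linarith
  have h3 := inv_pos.2 (Real.sqrt_pos.2 h1)
  simp only [mid, oinner_add_right, oinner_smul_right, nx]
  have : 0 < 1 + oinner x y := by linarith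
  have := mul_pos h3 this
  linarith
theorem mid_right {x y : Octonion} (nx : oinner x x = 1) (ny : oinner y y = 1)
    (h : -1 < oinner x y) : -(1 / 2) < oinner (mid x y) y := by
  have h1 : 0 < 2 + 2 * oinner x y := by linarith
  have h3 := inv_pos.2 (Real.sqrt_pos.2 h1)
  simp only [mid, oinner_add_left, oinner_smul_left, ny]
  have : 0 < oinner x y + 1 := by linarith
  have := mul_pos h3 this
  linarith
theorem mid_re {x y : Octonion} (rx : re x = 0) (ry : re y = 0) : re (mid x y) = 0 := by
  simp only [mid, re_smul, re_add, rx, ry]; ring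

theorem contOn_uu {X : Type*} [TopologicalSpace X] {f g : X → Octonion} {s : Set X}
    (hf : ContinuousOn f s) (hg : ContinuousOn g s) (h : ∀ x ∈ s, -(1 / 2) < oinner (f x) (g x)) :
    ContinuousOn (fun x => uu (f x) (g x)) s := by
  have hi := contOn_oinner hf hg
  refine ContinuousOn.smul (ContinuousOn.inv₀ (continuousOn_const.mul (continuousOn_const.add hi)) ?_) ?_
  · intro x hx
    have := h x hx
    exact mul_ne_zero (Real.sqrt_pos.2 (by norm_num)).ne'
      (by show (1 : ℝ) + oinner (f x) (g x) ≠ 0; linarith)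
  · exact ((continuousOn_const.add (continuousOn_const.mul hi)).sqrt.smul (hf.add hg)).add
      ((hf.mul hg).add (hi.smul continuousOn_const))

theorem contOn_mid {X : Type*} [TopologicalSpace X] {f g : X → Octonion} {s : Set X}
    (hf : ContinuousOn f s) (hg : ContinuousOn g s) (h : ∀ x ∈ s, -1 < oinner (f x) (g x)) :
    ContinuousOn (fun x => mid (f x) (g x)) s := by
  have hi := contOn_oinner hf hg
  refine ContinuousOn.smul (ContinuousOn.inv₀
    (continuousOn_const.add (continuousOn_const.mul hi)).sqrt ?_) (hf.add hg)
  intro x hx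
  have := h x hx
  exact (Real.sqrt_pos.2 (by show (0 : ℝ) < 2 + 2 * oinner (f x) (g x); linarith)).ne'

/-- local sections over the six-sphere -/
theorem section6 {x0 : Octonion} (r0 : re x0 = 0) (n0 : oinner x0 x0 = 1) :
    ∃ s : Octonion → G2, ContinuousOn s {x | re x = 0 ∧ oinner x x = 1 ∧ x ≠ -x0} ∧
      ∀ x, (re x = 0 ∧ oinner x x = 1 ∧ x ≠ -x0) → (s x).1 oi = x := by
  classical
  obtain ⟨κ, hκ⟩ := exists_g1 BT_std.rx BT_std.nx r0 n0
  set S : Set Octonion := {x | re x = 0 ∧ oinner x x = 1 ∧ x ≠ -x0} with hS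
  have hlt : ∀ x ∈ S, -1 < oinner x0 x := fun x hx => oinner_lt n0 hx.2.1 hx.2.2
  let s : Octonion → G2 := fun x => if h : x ∈ S then
    cG (uu (mid x0 x) x) (uu_re (mid_re r0 h.1) h.1)
      (uu_norm (mid_re r0 h.1) h.1 (mid_norm n0 h.2.1 (hlt x h)) h.2.1
        (mid_right n0 h.2.1 (hlt x h))) *
    (cG (uu x0 (mid x0 x)) (uu_re r0 (mid_re r0 h.1))
      (uu_norm r0 (mid_re r0 h.1) n0 (mid_norm n0 h.2.1 (hlt x h))
        (mid_left n0 h.2.1 (hlt x h))) * κ) else 1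
  refine ⟨s, ?_, ?_⟩
  · refine continuousOn_g2.2 fun w => ?_
    have hm : ContinuousOn (fun x => mid x0 x) S := contOn_mid continuousOn_const continuousOn_id hlt
    have h0 : ContinuousOn (fun x => uu (mid x0 x) x) S :=
      contOn_uu (g := fun x => x) hm continuousOn_id fun x hx => mid_right n0 hx.2.1 (hlt x hx)
    have h1 : ContinuousOn (fun x => au (uu (mid x0 x) x)) S :=
      continuousOn_const.add (h0.const_smul (Real.sqrt 3 / 2))
    have h0' : ContinuousOn (fun x => uu x0 (mid x0 x)) S :=
      contOn_uu (f := fun _ => x0) continuousOn_const hm fun x hx => mid_left n0 hx.2.1 (hlt x hx)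
    have h2 : ContinuousOn (fun x => au (uu x0 (mid x0 x))) S :=
      continuousOn_const.add (h0'.const_smul (Real.sqrt 3 / 2))
    refine ContinuousOn.congr (f := fun x => au (uu (mid x0 x) x) *
      ((au (uu x0 (mid x0 x)) * (κ.1 w * star (au (uu x0 (mid x0 x))))) *
        star (au (uu (mid x0 x) x)))) ?_ ?_
    · exact h1.mul ((h2.mul (continuousOn_const.mul h2.star)).mul h1.star)
    · intro x hx
      simp only [s, dif_pos hx, g_mul_apply, cG_apply']
  · intro x hx
    have hx' : x ∈ S := hx
    simp only [s, dif_pos hx', g_mul_apply, hκ]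
    rw [cG_uu r0 (mid_re r0 hx.1) n0 (mid_norm n0 hx.2.1 (hlt x hx)), cG_uu (mid_re r0 hx.1) hx.1
      (mid_norm n0 hx.2.1 (hlt x hx)) hx.2.1]
    · exact mid_right n0 hx.2.1 (hlt x hx)
    · exact mid_left n0 hx.2.1 (hlt x hx)

def P5 (x : Octonion) : Prop := re x = 0 ∧ oinner oi x = 0 ∧ oinner x x = 1

theorem sec5_BT {y1 z1 y : Octonion} (hb : BT oi y1 z1) (hy : P5 y) (hne : y ≠ -y1)
    {p q r s D : ℝ} (hp : p = 1 + oinner y1 y) (hq : q = oinner y1 (oi * y))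
    (hr : r = oinner z1 y) (hs : s = oinner z1 (oi * y)) (hD : D = p * p + q * q) :
    BT oi y (z1 - (D⁻¹ * (r * p + s * q)) • (y + y1) - (D⁻¹ * (s * p - r * q)) • (oi * (y + y1))) := by
  have hp0 : 0 < p := by rw [hp]; linarith [oinner_lt hb.ny hy.2.2 hne]
  have hD0 : D⁻¹ * D = 1 := inv_mul_cancel₀ (by rw [hD]; nlinarith)
  generalize D⁻¹ = δ at *
  have hoi := BT_std.rx
  have noi := BT_std.nx
  obtain ⟨ry, iy, ny⟩ := hy
  have J1 : ∀ a b, oinner (oi * a) (oi * b) = oinner a b := fun a b => by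
    rw [oinner_mul_mul_left, noi, one_mul]
  have J2 : ∀ a b, oinner (oi * a) b = -oinner a (oi * b) := fun a b => by
    rw [oinner_mul_left, ostar_im hoi, neg_mul, oinner_neg_right]
  have J3 : ∀ a, oinner a (oi * a) = 0 := fun a => by
    have := J2 a a
    rw [oinner_comm] at this
    linarith
  have J4 : ∀ b, oinner oi (oi * b) = re b := fun b => by
    have := J1 1 b
    rwa [mul_one, oinner_one_left] at this
  have J5 : ∀ b, re (oi * b) = - oinner oi b := fun b => by
    rw [re_mul_comm, re_mul_im hoi, oinner_comm]
  have J6 : ∀ b, oi * (oi * b) = -b := fun b => by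
    rw [mul_mul_im hoi, noi, one_smul]
  have hE : δ * (p * p + q * q) = 1 := by rw [← hD, hD0]
  have h1 : oinner z1 y1 = 0 := by rw [oinner_comm, hb.yz]
  have h2 : oinner z1 (oi * y1) = 0 := by rw [oinner_comm, hb.xyz]
  have h3 : oinner y1 y = p - 1 := by linarith
  have h4 : oinner y y1 = p - 1 := by rw [oinner_comm]; linarith
  have h5 : oinner y z1 = r := by rw [oinner_comm, hr]
  have h6 : oinner y (oi * z1) = -s := by rw [hs, ← neg_neg (oinner y (oi * z1)), ← J2, oinner_comm]
  have h7 : oinner y (oi * y1) = -q := by rw [hq, ← neg_neg (oinner y (oi * y1)), ← J2, oinner_comm]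
  have h8 : oinner y1 z1 = 0 := hb.yz
  have h9 : oinner y1 (oi * z1) = 0 := by
    rw [← neg_neg (oinner y1 (oi * z1)), ← J2, hb.xyz, neg_zero]
  constructor
  · exact hoi
  · exact ry
  · simp only [re_sub, re_smul, re_add, J5, oinner_add_right, hb.rz, ry, hb.ry, iy, hb.xy]; ring
  · exact noi
  · exact ny
  · simp only [oinner_sub_left, oinner_sub_right, oinner_add_left, oinner_add_right,
      oinner_smul_left, oinner_smul_right, mul_add, mul_sub, mul_smul_comm,
      J1, J2, J3, J6, oinner_neg_right, hb.nz, ny, hb.ny, h1, h2, h3, h4,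
      h5, h6, h7, h8, h9, ← hr, ← hs, ← hq]
    linear_combination (2 * p * δ * (r * r + s * s)) * hE
  · exact iy
  · simp only [oinner_sub_right, oinner_smul_right, oinner_add_right, J4, hb.xz, ry, hb.ry, iy,
      hb.xy, re_add]; ring
  · simp only [oinner_sub_left, oinner_sub_right, oinner_add_left, oinner_add_right,
      oinner_smul_left, oinner_smul_right, mul_add, mul_sub, mul_smul_comm,
      J1, J2, J3, J6, oinner_neg_right, hb.nz, ny, hb.ny, h1, h2, h3, h4,
      h5, h6, h7, h8, h9, ← hr, ← hs, ← hq]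
    linear_combination (-r) * hE
  · simp only [oinner_sub_left, oinner_sub_right, oinner_add_left, oinner_add_right,
      oinner_smul_left, oinner_smul_right, mul_add, mul_sub, mul_smul_comm,
      J1, J2, J3, J6, oinner_neg_right, hb.nz, ny, hb.ny, h1, h2, h3, h4,
      h5, h6, h7, h8, h9, ← hr, ← hs, ← hq]
    linear_combination (-s) * hE
end Octonion

end

noncomputable section
set_option linter.unusedSimpArgs false
namespace Octonion
open scoped Quaternion
open Metric

/-- the stabilizer of a vector -/
def stabG (e : Octonion) : Subgroup G2 where
  carrier := {g | g.1 e = e}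
  one_mem' := rfl
  mul_mem' := by
    intro a b ha hb
    show a.1 (b.1 e) = e
    rw [show b.1 e = e from hb, show a.1 e = e from ha]
  inv_mem' := by
    intro a ha
    show (a⁻¹).1 e = e
    nth_rewrite 1 [← show a.1 e = e from ha]
    exact g_inv_apply a e

theorem mem_stabG {e : Octonion} {g : G2} : g ∈ stabG e ↔ g.1 e = e := Iff.rfl

theorem section5 {y1 : Octonion} (h1 : P5 y1) :
    ∃ s : Octonion → stabG oi, ContinuousOn s {y | P5 y ∧ y ≠ -y1} ∧
      ∀ y, P5 y ∧ y ≠ -y1 → (s y).1.1 oj = y := by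
  classical
  obtain ⟨z1, hb⟩ := exists_BT2 BT_std.rx h1.1 BT_std.nx h1.2.2 h1.2.1
  let S : Set Octonion := {y | P5 y ∧ y ≠ -y1}
  let p : Octonion → ℝ := fun y => 1 + oinner y1 y
  let q : Octonion → ℝ := fun y => oinner y1 (oi * y)
  let r : Octonion → ℝ := fun y => oinner z1 y
  let s : Octonion → ℝ := fun y => oinner z1 (oi * y)
  let D : Octonion → ℝ := fun y => p y * p y + q y * q y
  let z : Octonion → Octonion := fun y => z1 - ((D y)⁻¹ * (r y * p y + s y * q y)) • (y + y1)
    - ((D y)⁻¹ * (s y * p y - r y * q y)) • (oi * (y + y1))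
  have hz : ∀ y ∈ S, BT oi y (z y) := fun y hy => sec5_BT hb hy.1 hy.2 rfl rfl rfl rfl rfl
  have hD : ∀ y ∈ S, D y ≠ 0 := by
    intro y hy
    have : 0 < p y := by
      show 0 < 1 + oinner y1 y
      linarith [oinner_lt hb.ny hy.1.2.2 hy.2]
    have h3 : 0 < D y := by show 0 < p y * p y + q y * q y; nlinarith
    exact h3.ne'
  have hcp : Continuous p := by fun_prop
  have hcq : Continuous q := by fun_prop
  have hcr : Continuous r := by fun_prop
  have hcs : Continuous s := by fun_prop
  have hcD : Continuous D := by fun_prop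
  have hcz : Continuous (fun y : S => z y.1) := by
    have hDi : Continuous (fun y : S => (D y.1)⁻¹) :=
      (hcD.comp continuous_subtype_val).inv₀ fun y => hD y.1 y.2
    have hv : Continuous (fun y : S => y.1) := continuous_subtype_val
    exact (continuous_const.sub ((hDi.mul (((hcr.comp hv).mul (hcp.comp hv)).add
      ((hcs.comp hv).mul (hcq.comp hv)))).smul (hv.add continuous_const))).sub
      ((hDi.mul (((hcs.comp hv).mul (hcp.comp hv)).sub
      ((hcr.comp hv).mul (hcq.comp hv)))).smul (continuous_const.mul (hv.add continuous_const)))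
  refine ⟨fun y => if h : y ∈ S then ⟨triG oi y (z y) (hz y h), mkT_oi _ _ _⟩ else 1, ?_, ?_⟩
  · rw [continuousOn_iff_continuous_domRestrict]
    have : Continuous (fun y : S => (⟨triG oi y.1 (z y.1) (hz y.1 y.2), mkT_oi _ _ _⟩ : stabG oi)) := by
      refine Continuous.subtype_mk ?_ _
      refine continuous_g2.2 fun w => ?_
      exact cont_mkT continuous_const continuous_subtype_val hcz continuous_const
    convert this using 1
    funext y
    exact dif_pos y.2
  · intro y hy
    have : (if h : y ∈ S then (⟨triG oi y (z y) (hz y h), mkT_oi _ _ _⟩ : stabG oi) else 1) =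
      ⟨triG oi y (z y) (hz y hy), mkT_oi _ _ _⟩ := dif_pos hy
    show (if h : y ∈ S then (⟨triG oi y (z y) (hz y h), mkT_oi _ _ _⟩ : stabG oi) else 1).1.1 oj = y
    rw [this]
    exact mkT_oj _ _ _

theorem stage {V : Type*} [NormedAddCommGroup V] [InnerProductSpace ℝ V] [FiniteDimensional ℝ V]
    (emb : V →ₗ[ℝ] Octonion) (proj : Octonion →ₗ[ℝ] V)
    (hin : ∀ v, oinner (emb v) (emb v) = ‖v‖ ^ 2) (hpe : ∀ v, proj (emb v) = v)
    {G : Type*} [Group G] [TopologicalSpace G] [IsTopologicalGroup G] (ψ : G →* G2)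
    (hψc : Continuous ψ) {e : Octonion} (he : oinner e e = 1)
    (hψ : ∀ g, emb (proj ((ψ g).1 e)) = (ψ g).1 e) (H : Subgroup G)
    (hH : ∀ g, g ∈ H ↔ (ψ g).1 e = e)
    (sec : ∀ x0, emb (proj x0) = x0 → oinner x0 x0 = 1 → ∃ s : Octonion → G,
      ContinuousOn s {x | emb (proj x) = x ∧ oinner x x = 1 ∧ x ≠ -x0} ∧
      ∀ x, (emb (proj x) = x ∧ oinner x x = 1 ∧ x ≠ -x0) → (ψ (s x)).1 e = x) :
    ∃ p : G → sphere (0 : V) 1, SphereTriv H p := by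
  have ce : Continuous emb := emb.continuous_of_finiteDimensional
  have : FiniteDimensional ℝ Octonion :=
    inferInstanceAs (FiniteDimensional ℝ (Quaternion ℝ × Quaternion ℝ))
  have cp : Continuous proj := proj.continuous_of_finiteDimensional
  have hn : ∀ g, proj ((ψ g).1 e) ∈ sphere (0 : V) 1 := by
    intro g
    have h1 := hin (proj ((ψ g).1 e))
    rw [hψ, g_inner, he] at h1
    rw [mem_sphere_zero_iff_norm]
    have := norm_nonneg (proj ((ψ g).1 e))
    nlinarith
  let p : G → sphere (0 : V) 1 := fun g => ⟨proj ((ψ g).1 e), hn g⟩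
  refine ⟨p, sphereTriv_of_sections H p ?_ ?_ ?_⟩
  · exact Continuous.subtype_mk (cp.comp ((cont_app e).comp hψc)) _
  · intro g h
    rw [hH, map_mul, map_inv, g_mul_apply, Subtype.mk.injEq]
    constructor
    · intro hgh
      have := congrArg emb hgh
      rw [hψ, hψ] at this
      rw [← this, g_inv_apply]
    · intro hgh
      have := congrArg (ψ g).1 hgh
      rw [g_inv_apply'] at this
      rw [this]
  · intro v
    have h1 : ∀ w : sphere (0 : V) 1, oinner (emb w) (emb w) = 1 := fun w => by
      rw [hin, norm_eq_of_mem_sphere, one_pow]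
    obtain ⟨s, hs, hs'⟩ := sec (emb (-v : sphere (0 : V) 1)) (by rw [hpe]) (h1 _)
    have hm : ∀ w : sphere (0 : V) 1, w ≠ v → (emb (proj (emb w)) = emb w ∧
      oinner (emb w) (emb w) = 1 ∧ emb w ≠ -emb (-v : sphere (0 : V) 1)) := by
      intro w hw
      refine ⟨by rw [hpe], h1 w, fun h => hw ?_⟩
      rw [← map_neg] at h
      have := congrArg proj h
      rw [hpe, hpe] at this
      apply Subtype.ext
      rw [this]; simp
    refine ⟨fun w => s (emb w), ?_, ?_⟩
    · exact hs.comp (ce.comp continuous_subtype_val).continuousOn fun w hw => hm w hw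
    · intro w hw
      apply Subtype.ext
      show proj ((ψ (s (emb w))).1 e) = w
      rw [hs' _ (hm w hw), hpe]

/-- the octonion with given coordinates -/
def o8 (a b c d e f g h : ℝ) : Octonion :=
  ((⟨a, b, c, d⟩ : Quaternion ℝ), (⟨e, f, g, h⟩ : Quaternion ℝ))
section o8
variable (a b c d e f g h : ℝ)
@[simp] theorem o8_1_re : (o8 a b c d e f g h).1.re = a := rfl
@[simp] theorem o8_1_imI : (o8 a b c d e f g h).1.imI = b := rfl
@[simp] theorem o8_1_imJ : (o8 a b c d e f g h).1.imJ = c := rfl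
@[simp] theorem o8_1_imK : (o8 a b c d e f g h).1.imK = d := rfl
@[simp] theorem o8_2_re : (o8 a b c d e f g h).2.re = e := rfl
@[simp] theorem o8_2_imI : (o8 a b c d e f g h).2.imI = f := rfl
@[simp] theorem o8_2_imJ : (o8 a b c d e f g h).2.imJ = g := rfl
@[simp] theorem o8_2_imK : (o8 a b c d e f g h).2.imK = h := rfl
end o8

def emb7 : EuclideanSpace ℝ (Fin 7) →ₗ[ℝ] Octonion where
  toFun v := o8 0 (v 0) (v 1) (v 2) (v 3) (v 4) (v 5) (v 6)
  map_add' v w := by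
    apply oext <;> apply Quaternion.ext <;> simp [add_fst, add_snd]
  map_smul' c v := by
    apply oext <;> apply Quaternion.ext <;> simp [smul_fst, smul_snd]


@[simp] theorem emb7_apply (v) : emb7 v = o8 0 (v 0) (v 1) (v 2) (v 3) (v 4) (v 5) (v 6) := rfl

def proj7 : Octonion →ₗ[ℝ] EuclideanSpace ℝ (Fin 7) where
  toFun x := !₂[x.1.imI, x.1.imJ, x.1.imK, x.2.re, x.2.imI, x.2.imJ, x.2.imK]
  map_add' v w := by
    ext i; fin_cases i <;> simp [add_fst, add_snd]
  map_smul' c v := by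
    ext i; fin_cases i <;> simp [smul_fst, smul_snd]

def emb6 : EuclideanSpace ℝ (Fin 6) →ₗ[ℝ] Octonion where
  toFun v := o8 0 0 (v 0) (v 1) (v 2) (v 3) (v 4) (v 5)
  map_add' v w := by
    apply oext <;> apply Quaternion.ext <;> simp [add_fst, add_snd]
  map_smul' c v := by
    apply oext <;> apply Quaternion.ext <;> simp [smul_fst, smul_snd]


@[simp] theorem emb6_apply (v) : emb6 v = o8 0 0 (v 0) (v 1) (v 2) (v 3) (v 4) (v 5) := rfl

def proj6 : Octonion →ₗ[ℝ] EuclideanSpace ℝ (Fin 6) where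
  toFun x := !₂[x.1.imJ, x.1.imK, x.2.re, x.2.imI, x.2.imJ, x.2.imK]
  map_add' v w := by
    ext i; fin_cases i <;> simp [add_fst, add_snd]
  map_smul' c v := by
    ext i; fin_cases i <;> simp [smul_fst, smul_snd]

@[simp] theorem proj7_apply (x : Octonion) : proj7 x =
    !₂[x.1.imI, x.1.imJ, x.1.imK, x.2.re, x.2.imI, x.2.imJ, x.2.imK] := rfl
@[simp] theorem proj6_apply (x : Octonion) : proj6 x =
    !₂[x.1.imJ, x.1.imK, x.2.re, x.2.imI, x.2.imJ, x.2.imK] := rfl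

theorem oinner_oi (x : Octonion) : oinner oi x = x.1.imI := by
  rw [oinner_def']; simp [oi]

theorem emb7_iff (x : Octonion) : emb7 (proj7 x) = x ↔ re x = 0 := by
  constructor
  · intro h; rw [← h]; rfl
  · intro h
    have h' : x.1.re = 0 := h
    apply oext <;> apply Quaternion.ext <;> simp [h']

theorem emb6_iff (x : Octonion) : emb6 (proj6 x) = x ↔ re x = 0 ∧ oinner oi x = 0 := by
  rw [oinner_oi]
  constructor
  · intro h; rw [← h]; exact ⟨rfl, rfl⟩
  · rintro ⟨h, h2⟩
    have h' : x.1.re = 0 := h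
    apply oext <;> apply Quaternion.ext <;> simp [h', h2]

theorem stage1 : ∃ p : G2 → sphere (0 : EuclideanSpace ℝ (Fin 7)) 1, SphereTriv (stabG oi) p := by
  refine stage emb7 proj7 ?_ ?_ (MonoidHom.id G2) continuous_id BT_std.nx ?_ (stabG oi) ?_ ?_
  · intro v
    rw [EuclideanSpace.norm_sq_eq, oinner_def']
    simp [Fin.sum_univ_succ]
    ring
  · intro v
    ext i; fin_cases i <;> simp
  · intro g
    rw [emb7_iff, g_re]; exact BT_std.rx
  · intro g; rfl
  · intro x0 h h'
    rw [emb7_iff] at h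
    simp only [emb7_iff]
    exact section6 h h'

def H2 : Subgroup (stabG oi) := (stabG oj).subgroupOf (stabG oi)

theorem stage2 : ∃ p : stabG oi → sphere (0 : EuclideanSpace ℝ (Fin 6)) 1, SphereTriv H2 p := by
  refine stage emb6 proj6 ?_ ?_ (stabG oi).subtype continuous_subtype_val BT_std.ny ?_ H2 ?_ ?_
  · intro v
    rw [EuclideanSpace.norm_sq_eq, oinner_def']
    simp [Fin.sum_univ_succ]
    ring
  · intro v
    ext i; fin_cases i <;> simp
  · intro g
    rw [emb6_iff]
    refine ⟨by rw [g_re]; exact BT_std.ry, ?_⟩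
    have h1 : g.1.1 oi = oi := g.2
    show oinner oi (g.1.1 oj) = 0
    nth_rewrite 1 [← h1]
    rw [g_inner]; exact BT_std.xy
  · intro g; rfl
  · intro x0 h h'
    rw [emb6_iff] at h
    simp only [emb6_iff]
    obtain ⟨s, hs, hs'⟩ := section5 (y1 := x0) ⟨h.1, h.2, h'⟩
    refine ⟨s, hs.mono ?_, ?_⟩
    · rintro x ⟨⟨a, b⟩, c, d⟩; exact ⟨⟨a, b, c⟩, d⟩
    · rintro x ⟨⟨a, b⟩, c, d⟩; exact hs' x ⟨⟨a, b, c⟩, d⟩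

end Octonion

end

noncomputable section
set_option linter.unusedSimpArgs false
namespace Octonion
open scoped Quaternion
open Metric

def inl (b : Quaternion ℝ) : Octonion := ((0 : Quaternion ℝ), b)
theorem inl_fst (b : Quaternion ℝ) : (inl b).1 = 0 := rfl
theorem inl_snd (b : Quaternion ℝ) : (inl b).2 = b := rfl
theorem oinner_inl (b : Quaternion ℝ) : oinner (inl b) (inl b) = ‖b‖ * ‖b‖ := by
  rw [oinner_def', ← Quaternion.normSq_eq_norm_mul_self, Quaternion.normSq_def', inl_fst, inl_snd]
  simp; ring

theorem BT_inl {b : Quaternion ℝ} (hb : ‖b‖ = 1) : BT oi oj (inl b) := by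
  refine ⟨BT_std.rx, BT_std.ry, rfl, BT_std.nx, BT_std.ny, ?_, BT_std.xy, ?_, ?_, ?_⟩
  · rw [oinner_inl, hb, one_mul]
  all_goals
    rw [oinner_def', inl_fst, inl_snd]
    simp [oi_snd, oj_snd, mul_snd]

theorem fix_ij_ol {g : G2} (hi : g.1 oi = oi) (hj : g.1 oj = oj) : g.1 ol = inl (g.1 ol).2 := by
  have h := g_BT g BT_std
  rw [hi, hj] at h
  have h1 := h.rz
  have h2 := h.xz
  have h3 := h.yz
  have h4 := h.xyz
  rw [oinner_def'] at h2 h3 h4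
  simp [mul_fst, mul_snd, oi_snd, oj_snd, oi_re, oi_imI, oi_imJ, oi_imK, oj_re, oj_imI, oj_imJ,
    oj_imK] at h2 h3 h4
  refine oext ?_ rfl
  apply Quaternion.ext <;> assumption

def fiberHomeo : H2 ≃ₜ sphere (0 : Quaternion ℝ) 1 where
  toFun g := ⟨(g.1.1.1 ol).2, by
    have h := fix_ij_ol (g := g.1.1) g.1.2 g.2
    have h2 := (g_BT g.1.1 BT_std).nz
    rw [h, oinner_inl] at h2
    rw [mem_sphere_zero_iff_norm]
    nlinarith [norm_nonneg (g.1.1.1 ol).2]⟩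
  invFun b := ⟨⟨triG oi oj (inl b) (BT_inl (norm_eq_of_mem_sphere b)), mkT_oi _ _ _⟩, mkT_oj _ _ _⟩
  left_inv g := by
    apply Subtype.ext; apply Subtype.ext
    apply g_ext_BT
    · exact (mkT_oi _ _ _).trans (g.1.2 : g.1.1.1 oi = oi).symm
    · exact (mkT_oj _ _ _).trans (g.2 : g.1.1.1 oj = oj).symm
    · exact (mkT_ol _ _ _).trans (fix_ij_ol (g := g.1.1) g.1.2 g.2).symm
  right_inv b := by
    apply Subtype.ext
    show ((triG oi oj (inl b) (BT_inl (norm_eq_of_mem_sphere b))).1 ol).2 = b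
    rw [triG_apply, mkT_ol, inl_snd]
  continuous_toFun := by
    refine Continuous.subtype_mk ?_ _
    exact cont_snd.comp ((cont_app ol).comp (continuous_subtype_val.comp continuous_subtype_val))
  continuous_invFun := by
    refine Continuous.subtype_mk (Continuous.subtype_mk (continuous_g2.2 fun w => ?_) _) _
    exact cont_mkT continuous_const continuous_const
      (cont_mk continuous_const continuous_subtype_val) continuous_const

theorem sc_H2 : SimplyConnectedSpace H2 := by
  have := sphere_simplyConnected (V := Quaternion ℝ) (by rw [Quaternion.finrank_eq_four]; norm_num)
  exact fiberHomeo.toHomotopyEquiv.simplyConnectedSpace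

theorem le_H2 : LocEuc 3 H2 := by
  intro x
  have : Fact (Module.finrank ℝ (Quaternion ℝ) = 3 + 1) := ⟨Quaternion.finrank_eq_four⟩
  exact ⟨fiberHomeo.toOpenPartialHomeomorph.trans (chartAt (EuclideanSpace ℝ (Fin 3)) (fiberHomeo x)), by simp⟩

theorem sc_G2 : SimplyConnectedSpace G2 := by
  obtain ⟨p1, h1⟩ := stage1
  obtain ⟨p2, h2⟩ := stage2
  have := sc_H2
  have := h2.simplyConnected (by simp)
  exact h1.simplyConnected (by simp)

theorem charted_G2 : Nonempty (ChartedSpace (EuclideanSpace ℝ (Fin 14)) G2) := by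
  obtain ⟨p1, h1⟩ := stage1
  obtain ⟨p2, h2⟩ := stage2
  have : Fact (Module.finrank ℝ (EuclideanSpace ℝ (Fin 7)) = 6 + 1) := ⟨by simp⟩
  have : Fact (Module.finrank ℝ (EuclideanSpace ℝ (Fin 6)) = 5 + 1) := ⟨by simp⟩
  exact (h1.locEuc (n := 6) (h2.locEuc (n := 5) (k := 8) le_H2 rfl) (k := 14) rfl).chartedSpace

theorem conn_G2 : ConnectedSpace G2 := by
  have := sc_G2
  infer_instance

end Octonion

end

noncomputable section
set_option linter.unusedSimpArgs false
namespace Octonion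
open scoped Quaternion

/-- unit imaginary octonions -/
def UI (x : Octonion) : Prop := re x = 0 ∧ oinner x x = 1

theorem UI.neg {x : Octonion} (h : UI x) : UI (-x) :=
  ⟨by rw [re_neg, h.1, neg_zero], by rw [oinner_neg_left, oinner_neg_right, neg_neg, h.2]⟩

theorem UI.g {x : Octonion} (h : UI x) (g : G2) : UI (g.1 x) :=
  ⟨by rw [g_re, h.1], by rw [g_inner, h.2]⟩

theorem UI_le {x y : Octonion} (hx : UI x) (hy : UI y) : 0 ≤ 1 - oinner x y * oinner x y := by
  have h := oinner_self_nonneg (y - oinner x y • x)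
  simp only [oinner_sub_left, oinner_sub_right, oinner_smul_left, oinner_smul_right, hx.2, hy.2,
    oinner_comm y x] at h
  linarith

theorem exists_frame {x y : Octonion} (hx : UI x) (hy : UI y) :
    ∃ e z, BT x e z ∧
      y = oinner x y • x + Real.sqrt (1 - oinner x y * oinner x y) • e := by
  have h0 := UI_le hx hy
  set c := oinner x y with hc
  have hn : oinner (y - c • x) (y - c • x) = 1 - c * c := by
    simp only [oinner_sub_left, oinner_sub_right, oinner_smul_left, oinner_smul_right, hx.2, hy.2,
      oinner_comm y x, ← hc]
    ring
  rcases h0.eq_or_lt with h1 | h1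
  · obtain ⟨e, z, hb⟩ := exists_BT1 hx.1 hx.2
    refine ⟨e, z, hb, ?_⟩
    rw [← h1] at hn ⊢
    rw [Real.sqrt_zero, zero_smul, add_zero]
    exact sub_eq_zero.1 (oinner_self_eq_zero hn)
  · have hs := Real.sqrt_pos.2 h1
    have hss := Real.mul_self_sqrt h0
    set s := Real.sqrt (1 - c * c)
    have hi : s⁻¹ * s = 1 := inv_mul_cancel₀ hs.ne'
    obtain ⟨z, he⟩ := exists_BT2 (x := x) (y := s⁻¹ • (y - c • x)) hx.1
        (by rw [re_smul, re_sub, re_smul, hx.1, hy.1]; ring) hx.2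
        (by rw [oinner_smul_left, oinner_smul_right, hn]
            linear_combination (-s⁻¹ * s⁻¹) * hss + (s⁻¹ * s + 1) * hi)
        (by rw [oinner_smul_right, oinner_sub_right, oinner_smul_right, hx.2, ← hc]; ring)
    refine ⟨_, _, he, ?_⟩
    rw [smul_smul, mul_comm, hi, one_smul]
    abel

theorem exists_g_pair {x y x' y' : Octonion} (hx : UI x) (hy : UI y) (hx' : UI x') (hy' : UI y')
    (h : oinner x y = oinner x' y') : ∃ g : G2, g.1 x = x' ∧ g.1 y = y' := by
  obtain ⟨e, z, hb, he⟩ := exists_frame hx hy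
  obtain ⟨e', z', hb', he'⟩ := exists_frame hx' hy'
  obtain ⟨g, h1, h2, -⟩ := exists_g hb hb'
  refine ⟨g, h1, ?_⟩
  rw [he, he', map_add, map_smul, map_smul, h1, h2, h]

section normal
variable {N : Subgroup G2}

def Aset (N : Subgroup G2) (t : ℝ) : Prop := ∃ x, UI x ∧ ∃ n ∈ N, oinner x (n.1 x) = t

theorem Aset_all {t : ℝ} (hN : N.Normal) (h : Aset N t) {x y : Octonion} (hx : UI x) (hy : UI y)
    (hxy : oinner x y = t) : ∃ n ∈ N, n.1 x = y := by
  obtain ⟨x0, h0, n, hn, hnx⟩ := h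
  obtain ⟨g, h1, h2⟩ := exists_g_pair h0 (h0.g n) hx hy (hnx.trans hxy.symm)
  refine ⟨g * n * g⁻¹, hN.conj_mem n hn g, ?_⟩
  rw [g_mul_apply, g_mul_apply, ← h1, g_inv_apply, h2]

theorem Aset_step {t r : ℝ} (hN : N.Normal) (h : Aset N t) (h1 : 2 * t * t - 1 ≤ r) (h2 : r ≤ 1) :
    Aset N r := by
  have ht : 0 ≤ 1 - t * t := by
    obtain ⟨x0, h0, n, hn, hnx⟩ := h
    rw [← hnx]; exact UI_le h0 (h0.g n)
  rcases h2.eq_or_lt with h3 | h3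
  · exact ⟨oi, ⟨BT_std.rx, BT_std.nx⟩, 1, N.one_mem, by rw [h3]; exact BT_std.nx⟩
  have ht' : 0 < 1 - t * t := by nlinarith
  set S := Real.sqrt (1 - t * t)
  have hS : S * S = 1 - t * t := Real.mul_self_sqrt ht
  set k := (r - t * t) / (1 - t * t) with hk
  have hk' : k * (1 - t * t) = r - t * t := div_mul_cancel₀ _ ht'.ne'
  have hk1 : -1 ≤ k := by rw [hk, le_div_iff₀ ht']; nlinarith
  have hk2 : k ≤ 1 := by rw [hk, div_le_iff₀ ht']; nlinarith
  set q := Real.sqrt (1 - k * k)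
  have hq : q * q = 1 - k * k := Real.mul_self_sqrt (by nlinarith)
  have B := BT_std
  have hm : UI oi := ⟨B.rx, B.nx⟩
  have e1 : oinner oj oi = 0 := by rw [oinner_comm, B.xy]
  have e2 : oinner ol oi = 0 := by rw [oinner_comm, B.xz]
  have e3 : oinner ol oj = 0 := by rw [oinner_comm, B.yz]
  have hx : UI (t • oi + S • oj) := by
    constructor
    · simp only [re_add, re_smul, B.rx, B.ry]; ring
    · simp only [oinner_add_left, oinner_add_right, oinner_smul_left, oinner_smul_right, B.nx, B.ny,
        B.xy, e1]
      linear_combination hS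
  have hy : UI (t • oi + S • (k • oj + q • ol)) := by
    constructor
    · simp only [re_add, re_smul, B.rx, B.ry, B.rz]; ring
    · simp only [oinner_add_left, oinner_add_right, oinner_smul_left, oinner_smul_right, B.nx, B.ny,
        B.nz, B.xy, B.xz, B.yz, e1, e2, e3]
      linear_combination hS + S * S * hq
  obtain ⟨n1, hn1, h4⟩ := Aset_all hN h hx hm (by
    simp only [oinner_add_left, oinner_smul_left, B.nx, e1]; ring)
  obtain ⟨n2, hn2, h5⟩ := Aset_all hN h hm hy (by
    simp only [oinner_add_right, oinner_smul_right, B.nx, B.xy, B.xz]; ring)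
  refine ⟨_, hx, n2 * n1, N.mul_mem hn2 hn1, ?_⟩
  rw [g_mul_apply, h4, h5]
  simp only [oinner_add_left, oinner_add_right, oinner_smul_left, oinner_smul_right, B.nx, B.ny,
        B.nz, B.xy, B.xz, B.yz, e1, e2, e3]
  linear_combination k * hS + hk'

theorem Aset_zero (hN : N.Normal) (k : ℕ) : ∀ t : ℝ, Aset N t → 0 ≤ t → 1 ≤ 2 ^ k * (1 - t) → Aset N 0 := by
  induction k with
  | zero =>
    intro t h h0 h1
    have : t = 0 := by linarith
    rwa [← this]
  | succ k ih =>
    intro t h h0 h1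
    have ht : 0 < 1 - t := by
      by_contra hc
      have : (0 : ℝ) < 2 ^ (k + 1) := by positivity
      nlinarith
    by_cases h2 : 2 * t * t - 1 ≤ 0
    · exact Aset_step hN h h2 zero_le_one
    · refine ih (2 * t * t - 1) (Aset_step hN h le_rfl (by nlinarith)) (by linarith) ?_
      have h3 : 2 * (1 - t) ≤ 1 - (2 * t * t - 1) := by nlinarith
      have : (0 : ℝ) < 2 ^ k := by positivity
      rw [pow_succ] at h1
      nlinarith

theorem Aset_neg_one (hN : N.Normal) {t : ℝ} (h : Aset N t) (ht : t < 1) : Aset N (-1) := by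
  have ht0 : 0 ≤ 1 - t * t := by
    obtain ⟨x0, h0, n, hn, hnx⟩ := h
    rw [← hnx]; exact UI_le h0 (h0.g n)
  by_cases h1 : t = -1
  · rwa [← h1]
  have h2 : -1 < t := lt_of_le_of_ne (by nlinarith) (Ne.symm h1)
  have h3 : Aset N 0 := by
    by_cases h4 : 2 * t * t - 1 ≤ 0
    · exact Aset_step hN h h4 zero_le_one
    · have h5 : Aset N (2 * t * t - 1) := Aset_step hN h le_rfl (by nlinarith)
      have h6 : 0 < 1 - (2 * t * t - 1) := by nlinarith
      obtain ⟨k, hk⟩ := pow_unbounded_of_one_lt (1 - (2 * t * t - 1))⁻¹ (one_lt_two : (1 : ℝ) < 2)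
      refine Aset_zero hN k _ h5 (by linarith) ?_
      rw [inv_lt_iff_one_lt_mul₀ h6] at hk
      linarith
  exact Aset_step hN h3 (by norm_num) (by norm_num)

theorem exists_flip (hN : N.Normal) (hb : N ≠ ⊥) {u : Octonion} (hu : UI u) : ∃ n ∈ N, n.1 u = -u := by
  obtain ⟨n, hn1⟩ := Subgroup.ne_bot_iff_exists_ne_one.1 hb
  obtain ⟨n, hn⟩ := n
  replace hn1 : n ≠ 1 := fun h => hn1 (Subtype.ext h)
  have : ∃ x, UI x ∧ n.1 x ≠ x := by
    by_contra hc
    push Not at hc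
    exact hn1 (g_ext_BT (hc oi ⟨BT_std.rx, BT_std.nx⟩) (hc oj ⟨BT_std.ry, BT_std.ny⟩)
      (hc ol ⟨BT_std.rz, BT_std.nz⟩))
  obtain ⟨x, hx, hnx⟩ := this
  have hlt : oinner x (n.1 x) < 1 := by
    have h1 : 0 < oinner (n.1 x - x) (n.1 x - x) :=
      lt_of_le_of_ne (oinner_self_nonneg _) fun h0 => hnx (sub_eq_zero.1 (oinner_self_eq_zero h0.symm))
    simp only [oinner_sub_left, oinner_sub_right, hx.2, g_inner, oinner_comm (n.1 x) x] at h1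
    linarith
  refine Aset_all hN (Aset_neg_one hN ⟨x, hx, n, hn, rfl⟩ hlt) hu hu.neg ?_
  rw [oinner_neg_right, hu.2]

theorem cG_perp {u x : Octonion} (hu : UI u) (hx : re x = 0) (h : oinner u x = 0) :
    (cG u hu.1 hu.2).1 x = (-(1 / 2) : ℝ) • x + (Real.sqrt 3 / 2) • (u * x) := by
  rw [cG_apply _ _ hx, h]; module

theorem cG_self {u : Octonion} (hu : UI u) : (cG u hu.1 hu.2).1 u = u := by
  rw [cG_apply _ _ hu.1, mul_self_im hu.1, hu.2]; module

theorem cG_sq {u : Octonion} (hu : UI u) :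
    cG u hu.1 hu.2 * cG u hu.1 hu.2 = cG (-u) hu.neg.1 hu.neg.2 := by
  have key : ∀ y, re y = 0 → oinner u y = 0 →
      (cG u hu.1 hu.2 * cG u hu.1 hu.2).1 y = (cG (-u) hu.neg.1 hu.neg.2).1 y := by
    intro y hy h
    rw [g_mul_apply, cG_perp hu hy h, cG_perp hu.neg hy (by rw [oinner_neg_left, h, neg_zero]),
      map_add, map_smul, map_smul, g_mul, cG_self hu, cG_perp hu hy h, mul_add, mul_smul_comm,
      mul_smul_comm, mul_mul_im hu.1, hu.2, neg_mul]
    have h3 : Real.sqrt 3 / 2 * (Real.sqrt 3 / 2) = 3 / 4 := by nlinarith [sqrt3]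
    generalize Real.sqrt 3 / 2 = k at *
    generalize u * y = v
    have h4 : (k * k) • y = (3 / 4 : ℝ) • y := by rw [h3]
    linear_combination (norm := module) -h4
  obtain ⟨y, z, hb⟩ := exists_BT1 hu.1 hu.2
  refine g_ext_BT' hb ?_ (key y hb.ry hb.xy) (key z hb.rz hb.xz)
  rw [g_mul_apply, cG_self hu, cG_self hu]
  have := cG_self hu.neg
  rw [map_neg] at this
  exact (neg_injective this).symm

theorem cG_conj {u : Octonion} (hu : UI u) (g : G2) :
    g * cG u hu.1 hu.2 * g⁻¹ = cG (g.1 u) (hu.g g).1 (hu.g g).2 := by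
  apply g_ext
  intro w
  rw [g_mul_apply, g_mul_apply, cG_apply', cG_apply', g_mul, g_mul, g_inv_apply', g_star]
  simp only [au, map_add, map_smul, g_one]

theorem cG_mem (hN : N.Normal) (hb : N ≠ ⊥) {u : Octonion} (hu : UI u) : cG u hu.1 hu.2 ∈ N := by
  obtain ⟨n, hn, hnu⟩ := exists_flip hN hb hu
  have h1 := cG_conj hu n
  have h2 : cG (n.1 u) (hu.g n).1 (hu.g n).2 = cG (-u) hu.neg.1 hu.neg.2 := by
    congr 1
  rw [h2, ← cG_sq hu] at h1
  set c := cG u hu.1 hu.2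
  have h3 : n * (c * n⁻¹ * c⁻¹) ∈ N := N.mul_mem hn (hN.conj_mem _ (N.inv_mem hn) c)
  have h4 : n * (c * n⁻¹ * c⁻¹) = c := by
    rw [← mul_assoc, ← mul_assoc, h1, mul_assoc, mul_inv_cancel, mul_one]
  rwa [h4] at h3

end normal
end Octonion

end

noncomputable section
set_option linter.unusedSimpArgs false
namespace Octonion
open scoped Quaternion

theorem exists_H (v : Octonion) : ∃ x, UI x ∧ x.2 = 0 ∧ oinner v x = 0 := by
  obtain ⟨x, hx, h⟩ := exists_perp ![1, v, o8 0 0 0 0 1 0 0 0, o8 0 0 0 0 0 1 0 0, o8 0 0 0 0 0 0 1 0,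
    o8 0 0 0 0 0 0 0 1, 0]
  have h0 := h 0
  have h1 := h 1
  have h2 := h 2
  have h3 := h 3
  have h4 := h 4
  have h5 := h 5
  simp [oinner_one_left] at h0 h1 h2 h3 h4 h5
  rw [oinner_def'] at h2 h3 h4 h5
  simp at h2 h3 h4 h5
  refine ⟨x, ⟨h0, hx⟩, ?_, h1⟩
  apply Quaternion.ext <;> assumption

theorem BT.neg {x y z : Octonion} (h : BT x y z) : BT x y (-z) := by
  refine ⟨h.rx, h.ry, ?_, h.nx, h.ny, ?_, h.xy, ?_, ?_, ?_⟩ <;>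
  simp only [re_neg, oinner_neg_left, oinner_neg_right, h.rz, h.nz, h.xz, h.yz, h.xyz] <;> norm_num

theorem fix_H {g : G2} (hi : g.1 oi = oi) (hj : g.1 oj = oj) {x : Octonion} (hx : x.2 = 0) :
    g.1 x = x := by
  have h0 : iota oi oj (0 : Quaternion ℝ) = 0 := by simp [iota]
  conv_rhs => rw [← mkT_std x]
  rw [g_eq_mkT, hi, hj, mkT, mkT, hx, h0, mul_zero, mul_zero]

theorem perp_H {v : Octonion} (h0 : re v = 0) (h1 : oinner oi v = 0) (h2 : oinner oj v = 0)
    (h3 : oinner (oi * oj) v = 0) : v.1 = 0 := by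
  rw [oinner_def'] at h1 h2 h3
  simp [mul_fst, mul_snd, oi_snd, oj_snd, oi_re, oi_imI, oi_imJ, oi_imK, oj_re, oj_imI, oj_imJ,
    oj_imK] at h1 h2 h3
  apply Quaternion.ext <;> assumption

theorem invol_perp {a b c v : Octonion} (hb : BT a b c) {g : G2} (ha : g.1 a = a) (hbb : g.1 b = b)
    (hc : g.1 c = -c) (h0 : re v = 0) (h1 : oinner a v = 0) (h2 : oinner b v = 0)
    (h3 : oinner (a * b) v = 0) : g.1 v = -v := by
  obtain ⟨k, rfl, rfl, rfl⟩ := exists_g BT_std hb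
  have hv : v = k.1 ((k⁻¹).1 v) := (g_inv_apply' k v).symm
  set w := (k⁻¹).1 v
  rw [hv] at h0 h1 h2 h3
  rw [← g_mul] at h3
  rw [g_re] at h0
  rw [g_inner] at h1 h2 h3
  have hw := perp_H h0 h1 h2 h3
  have hz : ∀ x y : Octonion, iota x y (0 : Quaternion ℝ) = 0 := by intro x y; simp [iota]
  rw [hv, g_eq_mkT k w, g_mkT, ha, hbb, hc, mkT, mkT, hw, hz]
  simp

section normal
variable {N : Subgroup G2}

theorem invol_conj (hN : N.Normal) {x y z a b c : Octonion} (h : BT x y z) (h' : BT a b c)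
    {s g : G2} (hs : s ∈ N) (h1 : s.1 x = x) (h2 : s.1 y = y) (h3 : s.1 z = -z)
    (h4 : g.1 a = a) (h5 : g.1 b = b) (h6 : g.1 c = -c) : g ∈ N := by
  obtain ⟨k, k1, k2, k3⟩ := exists_g h h'
  have : g = k * s * k⁻¹ := by
    apply g_ext_BT' h'
    · rw [g_mul_apply, g_mul_apply, h4, ← k1, g_inv_apply, h1]
    · rw [g_mul_apply, g_mul_apply, h5, ← k2, g_inv_apply, h2]
    · rw [g_mul_apply, g_mul_apply, h6, ← k3, g_inv_apply, h3, map_neg]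
  rw [this]
  exact hN.conj_mem s hs k

theorem exists_mu (b : Quaternion ℝ) (hb : oinner (inl b) (inl b) = 1) : ∃ m : Octonion, m.1 = 0 ∧
    oinner m m = 1 ∧ (∃ κ : ℝ, ol + inl b = κ • m) ∧ oinner m (ol - inl b) = 0 := by
  by_cases h : ol + inl b = 0
  · have hb' : inl b = -ol := eq_neg_of_add_eq_zero_right h
    refine ⟨o8 0 0 0 0 0 1 0 0, rfl, ?_, ⟨0, by rw [h, zero_smul]⟩, ?_⟩
    · rw [oinner_def']; simp
    · rw [hb', oinner_sub_right, oinner_neg_right, oinner_def']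
      simp [ol_fst, ol_snd]
  · have hpos : 0 < oinner (ol + inl b) (ol + inl b) :=
      lt_of_le_of_ne (oinner_self_nonneg _) fun h0 => h (oinner_self_eq_zero h0.symm)
    have hs := Real.sqrt_pos.2 hpos
    have hss := Real.mul_self_sqrt hpos.le
    set s := Real.sqrt (oinner (ol + inl b) (ol + inl b))
    have hi : s⁻¹ * s = 1 := inv_mul_cancel₀ hs.ne'
    refine ⟨s⁻¹ • (ol + inl b), ?_, ?_, ⟨s, ?_⟩, ?_⟩
    · rw [smul_fst, add_fst, ol_fst, inl_fst]; simp
    · rw [oinner_smul_left, oinner_smul_right, ← hss]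
      linear_combination (s⁻¹ * s + 1) * hi
    · rw [smul_smul, mul_comm, hi, one_smul]
    · simp only [oinner_smul_left, oinner_add_left, oinner_sub_right, BT_std.nz, hb,
        oinner_comm ol (inl b)]
      ring

theorem oinner_disj {x m : Octonion} (hx : x.2 = 0) (hm : m.1 = 0) : oinner x m = 0 := by
  rw [oinner_def', hx, hm]; simp
theorem BT_xmy {x m y : Octonion} (hx : UI x) (hx2 : x.2 = 0) (hy : UI y) (hy2 : y.2 = 0)
    (hxy : oinner x y = 0) (hm : m.1 = 0) (hmm : oinner m m = 1) : BT x m y := by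
  refine ⟨hx.1, ?_, hy.1, hx.2, hmm, hy.2, oinner_disj hx2 hm, hxy, ?_, ?_⟩
  · rw [re_def', hm]; rfl
  · rw [oinner_comm]; exact oinner_disj hy2 hm
  · rw [oinner_comm]
    refine oinner_disj hy2 ?_
    rw [mul_fst, hx2, hm]; simp

theorem fix_mem_std (hN : N.Normal)
    (hI : ∀ a b c (g : G2), BT a b c → g.1 a = a → g.1 b = b → g.1 c = -c → g ∈ N)
    {l : G2} (hi : l.1 oi = oi) (hj : l.1 oj = oj) : l ∈ N := by
  have hw := fix_ij_ol hi hj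
  set b := (l.1 ol).2
  have hbn : oinner (inl b) (inl b) = 1 := by rw [← hw, g_inner, BT_std.nz]
  obtain ⟨m, hm, hmm, ⟨κ, hκ⟩, hmp⟩ := exists_mu b hbn
  obtain ⟨x, hx, hx2, hxv⟩ := exists_H ((ol - inl b) * star m)
  obtain ⟨y, hy, hy2, hxy⟩ := exists_H x
  have B1 : BT x m y := BT_xmy hx hx2 hy hy2 hxy hm hmm
  have B2 : BT x ol y := BT_xmy hx hx2 hy hy2 hxy ol_fst BT_std.nz
  obtain ⟨A, A1, A2, A3⟩ := exists_g B1 B1.neg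
  obtain ⟨C, C1, C2, C3⟩ := exists_g B2 B2.neg
  have hd : A.1 (ol - inl b) = -(ol - inl b) := by
    refine invol_perp B1 A1 A2 A3 ?_ ?_ hmp ?_
    · rw [re_sub]; exact sub_self 0
    · refine oinner_disj hx2 ?_
      rw [sub_fst, ol_fst, inl_fst, sub_zero]
    · rw [oinner_mul_right, oinner_comm]; exact hxv
  have hs : A.1 (ol + inl b) = ol + inl b := by rw [hκ, map_smul, A2]
  have hz : A.1 ol = inl b := by
    rw [map_sub] at hd
    rw [map_add] at hs
    linear_combination (norm := module) (2⁻¹ : ℝ) • hd + (2⁻¹ : ℝ) • hs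
  have : l = A * C := by
    apply g_ext_BT' B2
    · rw [g_mul_apply, C1, A1, fix_H hi hj hx2]
    · rw [g_mul_apply, C2, hz, hw]
    · rw [g_mul_apply, C3, map_neg, A3, neg_neg, fix_H hi hj hy2]
  rw [this]
  exact N.mul_mem (hI _ _ _ _ B1 A1 A2 A3) (hI _ _ _ _ B2 C1 C2 C3)

theorem fix_mem (hN : N.Normal)
    (hI : ∀ a b c (g : G2), BT a b c → g.1 a = a → g.1 b = b → g.1 c = -c → g ∈ N)
    {x y z : Octonion} (hb : BT x y z) {l : G2} (hi : l.1 x = x) (hj : l.1 y = y) : l ∈ N := by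
  obtain ⟨k, rfl, rfl, -⟩ := exists_g BT_std hb
  have h : k⁻¹ * l * (k⁻¹)⁻¹ ∈ N := by
    apply fix_mem_std hN hI
    · rw [inv_inv, g_mul_apply, g_mul_apply, hi, g_inv_apply]
    · rw [inv_inv, g_mul_apply, g_mul_apply, hj, g_inv_apply]
  have h2 := hN.conj_mem _ h k
  have h3 : k * (k⁻¹ * l * (k⁻¹)⁻¹) * k⁻¹ = l := by group
  rwa [h3] at h2

theorem mul_swap {x y z : Octonion} (hx : re x = 0) : oinner (x * y) z = -oinner (x * z) y := by
  rw [oinner_mul_left, ostar_im hx, neg_mul, oinner_neg_right, oinner_comm]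

theorem top_of_invol (hN : N.Normal)
    (hI : ∀ a b c (g : G2), BT a b c → g.1 a = a → g.1 b = b → g.1 c = -c → g ∈ N) : N = ⊤ := by
  rw [Subgroup.eq_top_iff']
  intro g
  have B := BT_std
  have hgi : UI (g.1 oi) := UI.g ⟨B.rx, B.nx⟩ g
  obtain ⟨x, hx, hxp⟩ := exists_perp ![1, oi, g.1 oi, 0, 0, 0, 0]
  have a0 := hxp 0
  have a1 := hxp 1
  have a2 := hxp 2
  simp [oinner_one_left] at a0 a1 a2
  obtain ⟨y, hy, hyp⟩ := exists_perp ![1, x, oi, g.1 oi, x * oi, x * g.1 oi, 0]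
  have b0 := hyp 0
  have b1 := hyp 1
  have b2 := hyp 2
  have b3 := hyp 3
  have b4 := hyp 4
  have b5 := hyp 5
  simp [oinner_one_left] at b0 b1 b2 b3 b4 b5
  have B1 : BT x y (g.1 oi) := ⟨a0, b0, hgi.1, hx, hy, hgi.2, b1, by rw [oinner_comm, a2],
    by rw [oinner_comm, b3], by rw [mul_swap a0, b5, neg_zero]⟩
  have B2 : BT x y oi := ⟨a0, b0, B.rx, hx, hy, B.nx, b1, by rw [oinner_comm, a1],
    by rw [oinner_comm, b2], by rw [mul_swap a0, b4, neg_zero]⟩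
  obtain ⟨h, h1, h2, h3⟩ := exists_g B1 B2
  have hmem : h ∈ N := fix_mem hN hI B1 h1 h2
  have ki : (h * g).1 oi = oi := by rw [g_mul_apply, h3]
  set k := h * g with hk
  have hkj : UI (k.1 oj) := UI.g ⟨B.ry, B.ny⟩ k
  have hij : oinner oi (k.1 oj) = 0 := by
    have := g_inner k oi oj
    rwa [ki, B.xy] at this
  obtain ⟨v, hv, hvp⟩ := exists_perp ![1, oi, oj, k.1 oj, oi * oj, oi * k.1 oj, 0]
  have b0 := hvp 0
  have b1 := hvp 1
  have b2 := hvp 2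
  have b3 := hvp 3
  have b4 := hvp 4
  have b5 := hvp 5
  simp [oinner_one_left] at b0 b1 b2 b3 b4 b5
  have B1 : BT oi v (k.1 oj) := ⟨B.rx, b0, hkj.1, B.nx, hv, hkj.2, b1, hij,
    by rw [oinner_comm, b3], by rw [mul_swap B.rx, b5, neg_zero]⟩
  have B2 : BT oi v oj := ⟨B.rx, b0, B.ry, B.nx, hv, B.ny, b1, B.xy,
    by rw [oinner_comm, b2], by rw [mul_swap B.rx, b4, neg_zero]⟩
  obtain ⟨h', h1', h2', h3'⟩ := exists_g B1 B2
  have hmem' : h' ∈ N := fix_mem hN hI B1 h1' h2'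
  have hl : h' * k ∈ N := fix_mem hN hI BT_std
    (by rw [g_mul_apply, ki, h1']) (by rw [g_mul_apply, h3'])
  have h4 : k ∈ N := (N.mul_mem_cancel_left hmem').1 hl
  exact (N.mul_mem_cancel_left hmem).1 h4

/-- the quaternion as octonion -/
def inH (a : Quaternion ℝ) : Octonion := (a, (0 : Quaternion ℝ))
theorem inH_fst (b : Quaternion ℝ) : (inH b).1 = b := rfl
theorem inH_snd (b : Quaternion ℝ) : (inH b).2 = 0 := rfl

def qa (w : Quaternion ℝ) : Quaternion ℝ := (1 / 2 : ℝ) • (1 : Quaternion ℝ) + (Real.sqrt 3 / 2) • w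

theorem au_inH (w : Quaternion ℝ) : au (inH w) = inH (qa w) := by
  apply oext
  · rw [au, add_fst, smul_fst, smul_fst]; rfl
  · rw [au, add_snd, smul_snd, smul_snd, inH_snd, inH_snd, one_snd]; simp

theorem cG_inH {w : Quaternion ℝ} (hu : UI (inH w)) (x : Octonion) :
    ((cG (inH w) hu.1 hu.2).1 x).1 = qa w * x.1 * star (qa w) ∧
    ((cG (inH w) hu.1 hu.2).1 x).2 = star (qa w) * (star (qa w) * x.2) := by
  rw [cG_apply', au_inH]
  constructor
  · simp only [mul_fst, mul_snd, star_fst, star_snd, inH_fst, inH_snd]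
    simp [mul_assoc]
  · simp only [mul_fst, mul_snd, star_fst, star_snd, inH_fst, inH_snd]
    simp [mul_assoc]

def q4 (a b c d : ℝ) : Quaternion ℝ := ⟨a, b, c, d⟩
@[simp] theorem q4_re (a b c d : ℝ) : (q4 a b c d).re = a := rfl
@[simp] theorem q4_imI (a b c d : ℝ) : (q4 a b c d).imI = b := rfl
@[simp] theorem q4_imJ (a b c d : ℝ) : (q4 a b c d).imJ = c := rfl
@[simp] theorem q4_imK (a b c d : ℝ) : (q4 a b c d).imK = d := rfl

theorem qa_q4 (b c d : ℝ) : qa (q4 0 b c d) =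
    q4 (1 / 2) (Real.sqrt 3 / 2 * b) (Real.sqrt 3 / 2 * c) (Real.sqrt 3 / 2 * d) := by
  apply Quaternion.ext <;> simp [qa]

theorem exists_invol (hc : ∀ u (hu : UI u), cG u hu.1 hu.2 ∈ N) :
    ∃ s ∈ N, s.1 oi = oi ∧ s.1 oj = oj ∧ s.1 ol = -ol := by
  have h2 : Real.sqrt 2 * Real.sqrt 2 = 2 := Real.mul_self_sqrt (by norm_num)
  have h3 : Real.sqrt 3 * Real.sqrt 3 = 3 := Real.mul_self_sqrt (by norm_num)
  set r := Real.sqrt 2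
  have hu : UI (inH (q4 0 1 0 0)) := by
    constructor
    · rfl
    · rw [oinner_def', inH_fst, inH_snd]; simp
  have hu' : UI (inH (q4 0 (1 / 3) (2 * r / 3) 0)) := by
    constructor
    · rfl
    · rw [oinner_def', inH_fst, inH_snd]; simp; linear_combination (4 / 9) * h2
  set c := cG _ hu.1 hu.2 with hcc
  set c' := cG _ hu'.1 hu'.2 with hcc'
  have hαq := qa_q4 1 0 0
  have hβq := qa_q4 (1 / 3) (2 * r / 3) 0
  have kα := fun x => cG_inH hu x
  have kβ := fun x => cG_inH hu' x
  rw [hαq] at kα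
  rw [hβq] at kβ
  set s := Real.sqrt 3
  generalize hα : q4 (1 / 2) (s / 2 * 1) (s / 2 * 0) (s / 2 * 0) = α at kα
  generalize hβ : q4 (1 / 2) (s / 2 * (1 / 3)) (s / 2 * (2 * r / 3)) (s / 2 * 0) = β at kβ
  have hα2 : star α * star α = -α := by
    rw [← hα]
    apply Quaternion.ext <;> simp
    all_goals first | linear_combination (-1 / 4) * h3 | ring
  have hβ2 : star β * star β = -β := by
    rw [← hβ]
    apply Quaternion.ext <;> simp
    · linear_combination (-1 / 36 - 1 / 9 * r * r) * h3 - (1 / 3) * h2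
    all_goals ring
  have hab : α * β = q4 0 (s / 3) (s * r / 6) (r / 2) := by
    rw [← hα, ← hβ]
    apply Quaternion.ext <;> simp
    · linear_combination (-1 / 12) * h3
    · ring
    · ring
    · linear_combination (r / 6) * h3
  have hm : α * β * (α * β) = -1 := by
    rw [hab]
    apply Quaternion.ext <;> simp
    · linear_combination (-1 / 9 - r * r / 36) * h3 - (1 / 3) * h2
    all_goals ring
  have hms : star (α * β) = - (α * β) := by
    rw [hab]
    apply Quaternion.ext <;> simp
  have key : ∀ x, ((c * c').1 x).1 = α * β * x.1 * star (α * β) ∧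
     ((c * c').1 x).2 = α * β * x.2 := by
    intro x
    rw [g_mul_apply]
    constructor
    · rw [(kα _).1, (kβ _).1, star_mul]; simp only [mul_assoc]
    · rw [(kα _).2, (kβ _).2, ← mul_assoc (star β), hβ2, ← mul_assoc (star α), hα2]
      simp [mul_assoc]
  have key2 : ∀ x, ((c * c' * (c * c')).1 x).1 = x.1 ∧ ((c * c' * (c * c')).1 x).2 = - x.2 := by
    intro x
    rw [g_mul_apply]
    constructor
    · rw [(key _).1, (key _).1, hms]
      have : α * β * (α * β * x.1 * -(α * β)) * -(α * β) = (α * β * (α * β)) * x.1 * (α * β * (α * β)) := by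
        noncomm_ring
      rw [this, hm]; simp
    · rw [(key _).2, (key _).2, ← mul_assoc, hm]; simp
  refine ⟨c * c' * (c * c'), ?_, ?_, ?_, ?_⟩
  · have := N.mul_mem (hc _ hu) (hc _ hu')
    exact N.mul_mem this this
  · refine oext (key2 _).1 ((key2 _).2.trans ?_)
    rw [oi_snd, neg_zero]
  · refine oext (key2 _).1 ((key2 _).2.trans ?_)
    rw [oj_snd, neg_zero]
  · refine oext ((key2 _).1.trans ?_) (key2 _).2
    rw [neg_fst, ol_fst, neg_zero]

end normal

theorem simple_G2 : IsSimpleGroup G2 := by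
  have : Nontrivial G2 := by
    obtain ⟨A, A1, A2, A3⟩ := exists_g BT_std BT_std.neg
    refine ⟨A, 1, fun h => ?_⟩
    rw [h, g_one_apply] at A3
    have := congrArg (fun v => oinner v ol) A3
    simp only [oinner_neg_left, BT_std.nz] at this
    norm_num at this
  refine { eq_bot_or_eq_top_of_normal := fun N hN => ?_ }
  by_cases hb : N = ⊥
  · exact Or.inl hb
  right
  obtain ⟨s, hs, s1, s2, s3⟩ := exists_invol (N := N) fun u hu => cG_mem hN hb hu
  exact top_of_invol hN fun a b c g h h1 h2 h3 => invol_conj hN BT_std h hs s1 s2 s3 h1 h2 h3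

end Octonion

end

noncomputable section
set_option linter.unusedSimpArgs false
namespace Octonion

theorem mul_eq_cross {x y : Octonion} (hx : re x = 0) (hy : re y = 0) :
    x * y = cross x y - oinner x y • (1 : Octonion) := by
  have h := mul_anticomm hx hy
  rw [cross]
  linear_combination (norm := module) (2⁻¹ : ℝ) • h

theorem oinner_cross_self {x y : Octonion} (hx : re x = 0) (hy : re y = 0) :
    cross x (cross x y) = oinner x y • x - oinner x x • y := by
  have h1 := mul_mul_im hx y
  rw [mul_eq_cross hx hy, mul_sub, mul_smul_comm, mul_one, mul_eq_cross hx (re_cross x y)] at h1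
  have h2 := congrArg re h1
  simp only [re_sub, re_smul, re_neg, re_cross, hx, hy, re_one] at h2
  have h3 : oinner x (cross x y) = 0 := by linarith
  rw [h3] at h1
  linear_combination (norm := module) h1

theorem cross_inner {h : ImO ≃ₗ[ℝ] ImO} (hh : h ∈ AutImOCross) (x : ImO) :
    oinner (h x : Octonion) (h x : Octonion) = oinner (x : Octonion) x := by
  by_cases hx : (x : Octonion) = 0
  · have : x = 0 := Subtype.ext hx
    rw [this, map_zero]
  obtain ⟨y, hy, hyp⟩ := exists_perp ![1, x, 0, 0, 0, 0, 0]
  have b0 := hyp 0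
  have b1 := hyp 1
  simp [oinner_one_left] at b0 b1
  set Y : ImO := ⟨y, b0⟩
  have key : ∀ a b : ImO, crossI a (crossI a b) = oinner (a : Octonion) b • a - oinner (a : Octonion) a • b :=
    fun a b => Subtype.ext (oinner_cross_self a.2 b.2)
  have h1 := congrArg h (key x Y)
  rw [hh, hh, key, map_sub, map_smul, map_smul] at h1
  have h2 : h ((oinner (h x : Octonion) (h Y : Octonion)) • x - oinner (h x : Octonion) (h x) • Y) =
      h (oinner (x : Octonion) Y • x - oinner (x : Octonion) x • Y) := by
    rw [map_sub, map_sub, map_smul, map_smul, map_smul, map_smul]; exact h1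
  have h3 := congrArg (fun v : ImO => oinner (v : Octonion) y) (h.injective h2)
  have h4 : ∀ a b : ℝ, oinner ((a • x - b • Y : ImO) : Octonion) y = -b := by
    intro a b
    show oinner (a • (x : Octonion) - b • y) y = -b
    rw [oinner_sub_left, oinner_smul_left, oinner_smul_left, b1, hy]; ring
  simp only [h4] at h3
  linarith

theorem cross_inner' {h : ImO ≃ₗ[ℝ] ImO} (hh : h ∈ AutImOCross) (x y : ImO) :
    oinner (h x : Octonion) (h y : Octonion) = oinner (x : Octonion) y := by
  have h1 := cross_inner hh (x + y)
  rw [map_add] at h1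
  simp only [Submodule.coe_add, oinner_add_left, oinner_add_right, cross_inner hh x,
    cross_inner hh y, oinner_comm (y : Octonion) x, oinner_comm (h y : Octonion) (h x)] at h1
  linarith

/-- restriction of an automorphism to imaginary octonions -/
def resG (g : G2) : ImO ≃ₗ[ℝ] ImO where
  toFun v := ⟨g.1 v, (g_re g v).trans v.2⟩
  invFun v := ⟨(g⁻¹).1 v, (g_re g⁻¹ v).trans v.2⟩
  map_add' u v := Subtype.ext (map_add g.1 (u : Octonion) v)
  map_smul' r v := Subtype.ext (map_smul g.1 r (v : Octonion))
  left_inv v := Subtype.ext (g_inv_apply g v)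
  right_inv v := Subtype.ext (g_inv_apply' g v)

theorem resG_coe (g : G2) (v : ImO) : (resG g v : Octonion) = g.1 v := rfl

theorem resG_mem (g : G2) : resG g ∈ AutImOCross := by
  intro x y
  apply Subtype.ext
  show g.1 (cross x y) = cross (g.1 x) (g.1 y)
  rw [cross, cross, map_smul, map_sub, g_mul, g_mul]

/-- imaginary part -/
def imp (x : Octonion) : ImO := ⟨x - re x • (1 : Octonion), by
  show re _ = 0
  rw [re_sub, re_smul, re_one]; ring⟩

theorem imp_coe (x : Octonion) : (imp x : Octonion) = x - re x • (1 : Octonion) := rfl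
theorem imp_add (x y : Octonion) : imp (x + y) = imp x + imp y := by
  apply Subtype.ext
  rw [Submodule.coe_add, imp_coe, imp_coe, imp_coe, re_add]; module
theorem imp_smul (r : ℝ) (x : Octonion) : imp (r • x) = r • imp x := by
  apply Subtype.ext
  rw [Submodule.coe_smul, imp_coe, imp_coe, re_smul]; module

theorem re_ext (r : ℝ) (v : ImO) : re (r • (1 : Octonion) + (v : Octonion)) = r := by
  rw [re_add, re_smul, re_one, show re (v : Octonion) = 0 from v.2]; ring
theorem imp_ext (r : ℝ) (v : ImO) : imp (r • (1 : Octonion) + (v : Octonion)) = v := by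
  apply Subtype.ext
  rw [imp_coe, re_ext]; module
theorem re_imp (x : Octonion) : re x • (1 : Octonion) + (imp x : Octonion) = x := by
  rw [imp_coe]; module

/-- extension to all octonions -/
def extH (h : ImO ≃ₗ[ℝ] ImO) : Octonion ≃ₗ[ℝ] Octonion where
  toFun x := re x • (1 : Octonion) + (h (imp x) : Octonion)
  invFun x := re x • (1 : Octonion) + (h.symm (imp x) : Octonion)
  map_add' x y := by rw [imp_add, re_add, map_add, Submodule.coe_add]; module
  map_smul' r x := by
    rw [imp_smul, re_smul, map_smul, Submodule.coe_smul, RingHom.id_apply]; module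
  left_inv x := by
    beta_reduce
    rw [re_ext, imp_ext, h.symm_apply_apply, re_imp]
  right_inv x := by
    beta_reduce
    rw [re_ext, imp_ext, h.apply_symm_apply, re_imp]

theorem extH_apply (h : ImO ≃ₗ[ℝ] ImO) (x : Octonion) :
    extH h x = re x • (1 : Octonion) + (h (imp x) : Octonion) := rfl

theorem extH_coe (h : ImO ≃ₗ[ℝ] ImO) (r : ℝ) (x : ImO) :
    extH h (r • (1 : Octonion) + x) = r • (1 : Octonion) + h x := by rw [extH_apply, re_ext, imp_ext]

theorem ext_mul (r s : ℝ) (u v : ImO) : (r • (1 : Octonion) + u) * (s • (1 : Octonion) + v) =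
    (r * s - oinner (u : Octonion) v) • (1 : Octonion) + ((r • v + s • u + crossI u v : ImO) : Octonion) := by
  have : ((r • v + s • u + crossI u v : ImO) : Octonion) = r • (v : Octonion) + s • (u : Octonion) +
    cross u v := rfl
  rw [this, add_mul, mul_add, mul_add, smul_mul_assoc, one_mul, smul_mul_assoc, one_mul, mul_smul_comm, mul_one,
    mul_eq_cross u.2 v.2]
  module

theorem extH_mem {h : ImO ≃ₗ[ℝ] ImO} (hh : h ∈ AutImOCross) : extH h ∈ G2 := by
  intro x y
  rw [← re_imp x, ← re_imp y, ext_mul, extH_coe, extH_coe, extH_coe, ext_mul, cross_inner' hh,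
    map_add, map_add, map_smul, map_smul, hh]

/-- restriction homomorphism -/
def resHom : G2 →* AutImOCross where
  toFun g := ⟨resG g, resG_mem g⟩
  map_one' := rfl
  map_mul' _ _ := rfl

theorem resHom_bij : Function.Bijective resHom := by
  constructor
  · intro g g' h
    apply g_ext
    intro w
    have h1 : (resG g (imp w) : Octonion) = resG g' (imp w) := by
      have : resG g = resG g' := congrArg Subtype.val h
      rw [this]
    rw [resG_coe, resG_coe] at h1
    rw [← re_imp w, map_add, map_add, map_smul, map_smul, g_one, g_one, h1]
  · intro h
    refine ⟨⟨extH h.1, extH_mem h.2⟩, ?_⟩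
    apply Subtype.ext
    apply LinearEquiv.ext
    intro v
    apply Subtype.ext
    show extH h.1 v = h.1 v
    have := extH_coe h.1 0 v
    rwa [zero_smul, zero_add, zero_add] at this

def iso12 : G2 ≃* AutImOCross := MulEquiv.ofBijective resHom resHom_bij

/-- determinant on G2 -/
def detHom : G2 →* ℝ where
  toFun g := LinearMap.det (resG g : ImO →ₗ[ℝ] ImO)
  map_one' := LinearMap.det_id
  map_mul' a b := LinearMap.det_comp (resG a : ImO →ₗ[ℝ] ImO) (resG b : ImO →ₗ[ℝ] ImO)

theorem cube_one {d : ℝ} (h0 : d ≠ 0) (h : d * d * (d * d) = d) : d = 1 := by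
  have h1 : (d - 1) * (d * d + d + 1) = 0 := by
    apply mul_left_cancel₀ h0
    linear_combination h
  rcases mul_eq_zero.1 h1 with h2 | h2
  · linarith
  · nlinarith [sq_nonneg (d + 1), sq_nonneg d]

theorem det_cG {u : Octonion} (hu : UI u) : detHom (cG u hu.1 hu.2) = 1 := by
  have h1 := congrArg detHom (cG_sq hu)
  have h2 := congrArg detHom (cG_sq hu.neg)
  rw [map_mul] at h1 h2
  have h3 : detHom (cG (- -u) hu.neg.neg.1 hu.neg.neg.2) = detHom (cG u hu.1 hu.2) := by
    congr 2
    exact neg_neg u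
  rw [h3, ← h1] at h2
  refine cube_one ?_ h2
  intro h0
  have h4 : detHom (cG u hu.1 hu.2 * (cG u hu.1 hu.2)⁻¹) = 1 := by
    rw [mul_inv_cancel, map_one]
  rw [map_mul, h0, zero_mul] at h4
  exact zero_ne_one h4

theorem detHom_eq (g : G2) : detHom g = 1 := by
  have hs := simple_G2
  have hu : UI oi := ⟨BT_std.rx, BT_std.nx⟩
  rcases hs.eq_bot_or_eq_top_of_normal detHom.ker inferInstance with h | h
  · exfalso
    have h1 : cG oi hu.1 hu.2 ∈ detHom.ker := MonoidHom.mem_ker.2 (det_cG hu)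
    rw [h, Subgroup.mem_bot] at h1
    have h2 := cG_perp hu BT_std.ry BT_std.xy
    rw [h1, g_one_apply] at h2
    have h3 := congrArg (fun v => oinner v oj) h2
    simp only [oinner_add_left, oinner_smul_left, BT_std.ny, oinner_mul_right, mul_ostar,
      oinner_smul_right, oinner_one_right, BT_std.rx] at h3
    norm_num at h3
  · have : g ∈ detHom.ker := by rw [h]; trivial
    exact MonoidHom.mem_ker.1 this

theorem SO7_eq : AutImOCross = G2inSO7 := by
  ext h
  constructor
  · intro hh
    refine ⟨cross_inner' hh, ?_, fun x y z => ?_⟩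
    · obtain ⟨g, hg⟩ := resHom_bij.2 ⟨h, hh⟩
      have h1 : resG g = h := congrArg Subtype.val hg
      rw [← h1]
      exact detHom_eq g
    · have h1 : cross (h x : Octonion) (h y) = h (crossI x y) :=
        (congrArg Subtype.val (hh x y)).symm
      rw [h1, cross_inner' hh]; rfl
  · rintro ⟨h1, -, h2⟩ x y
    obtain ⟨w, hw⟩ := h.surjective (h (crossI x y) - crossI (h x) (h y))
    have h3 : oinner (h w : Octonion) (h w) = 0 := by
      have h5 : ∀ v : Octonion, oinner (h w : Octonion) v =
          oinner ((h (crossI x y) - crossI (h x) (h y) : ImO) : Octonion) v := fun v => by rw [hw]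
      rw [h5, Submodule.coe_sub, oinner_sub_left, h1]
      have := h2 x y w
      show oinner (cross (x : Octonion) y) w - oinner (cross (h x : Octonion) (h y)) (h w) = 0
      rw [this, sub_self]
    have h4 : h w = 0 := Subtype.ext (oinner_self_eq_zero h3)
    rw [hw] at h4
    exact sub_eq_zero.1 h4

def iso13 : G2 ≃* G2inSO7 := iso12.trans (MulEquiv.subgroupCongr SO7_eq)

end Octonion

end

theorem statement18 :
    -- (1) ≅ (2): the automorphism group of `𝕆` is isomorphic to the automorphism group
    -- of `(Im 𝕆, ×)`
    Nonempty (G2 ≃* AutImOCross) ∧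
    -- (1) ≅ (3): it is isomorphic to the subgroup of `SO(7)` preserving the associative
    -- 3-form `φ` (in particular `G₂` is contained in `SO(7)`)
    Nonempty (G2 ≃* G2inSO7) ∧
    -- `G₂` is compact, connected, simply connected and simple,
    CompactSpace G2 ∧ ConnectedSpace G2 ∧ SimplyConnectedSpace G2 ∧ IsSimpleGroup G2 ∧
    -- and it is a 14-dimensional manifold (a Lie group, its group operations being
    -- automatically smooth)
    Nonempty (ChartedSpace (EuclideanSpace ℝ (Fin 14)) G2) := by
  exact ⟨⟨Octonion.iso12⟩, ⟨Octonion.iso13⟩, inferInstance, Octonion.conn_G2, Octonion.sc_G2,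
    Octonion.simple_G2, Octonion.charted_G2⟩
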